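/- arXiv:1607.02622 — 3 statements merged into one kernel-verified Lean document; each statement's English description precedes it below -/
import Mathlib

section
/- Let φ be a Schwartz function on ℝ whose Fourier transform φ̂ is supported in [−1/100, 1/100], and let ϕ ∈ C^∞(ℝ) be supported in [−1/10, 1/10] and equal to 1 on [−1/20, 1/20]. For an integer N ≥ 1, let c_l = 1 if 9N/10 ≤ l ≤ 11N/10 and c_l = 0 otherwise, and for arbitrary signs ε_{j,k} ∈ {−1, +1} (1 ≤ j, k ≤ N) define σ_N(ξ₁, ξ₂) = Σ_{j=1}^N Σ_{k=1}^N ε_{j,k} c_{j+k} ϕ(Nξ₁ − j) ϕ(Nξ₂ − k), a smooth compactly supported function on ℝ². Then for every s ∈ (0,1) and every 1 < r < ∞ there exists a constant C, depending only on s, r and ϕ (not on N or the signs), such that ‖J_{−s}σ_N‖_{L^r(ℝ²)} ≤ C N^s. -/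
open MeasureTheory

noncomputable section

/-- The Fourier transform on `ℝ² = ℝ × ℝ`. -/
def ft2r (σ : ℝ × ℝ → ℂ) (ζ : ℝ × ℝ) : ℂ :=
  ∫ x : ℝ × ℝ, σ x * Complex.exp (-(2 * Real.pi * Complex.I) *
    ((x.1 * ζ.1 + x.2 * ζ.2 : ℝ) : ℂ))

/-- `(J_{-s}σ)(y) = ∫ (1 + 4π²|ζ|²)^{s/2} σ̂(ζ) e^{2πi y·ζ} dζ` on `ℝ²`. -/
def Jneg2 (s : ℝ) (σ : ℝ × ℝ → ℂ) (y : ℝ × ℝ) : ℂ :=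
  ∫ ζ : ℝ × ℝ, (((1 + 4 * Real.pi ^ 2 * (ζ.1 ^ 2 + ζ.2 ^ 2)) ^ (s / 2) : ℝ) : ℂ) *
    ft2r σ ζ * Complex.exp ((2 * Real.pi * Complex.I) * ((y.1 * ζ.1 + y.2 * ζ.2 : ℝ) : ℂ))

/-- The coefficient `c_l`: `1` if `9N/10 ≤ l ≤ 11N/10` and `0` otherwise. -/
def cN (N : ℕ) (l : ℕ) : ℝ :=
  if 9 * (N : ℝ) / 10 ≤ (l : ℝ) ∧ (l : ℝ) ≤ 11 * (N : ℝ) / 10 then 1 else 0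

/-- The multiplier `σ_N(ξ₁,ξ₂) = Σ_{j,k=1}^N ε_{j,k} c_{j+k} ϕ(Nξ₁-j) ϕ(Nξ₂-k)`. -/
def sigmaN (ϕ : ℝ → ℝ) (N : ℕ) (ε : ℕ → ℕ → ℝ) (ξ : ℝ × ℝ) : ℂ :=
  ((∑ j ∈ Finset.Icc 1 N, ∑ k ∈ Finset.Icc 1 N,
      ε j k * cN N (j + k) * ϕ ((N : ℝ) * ξ.1 - j) * ϕ ((N : ℝ) * ξ.2 - k) : ℝ) : ℂ)


/-- Indicator of `|x - j| ≤ 1/10`. -/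
def chiN (x : ℝ) (j : ℕ) : ℝ := if |x - j| ≤ 1 / 10 then 1 else 0

lemma chiN_nonneg (x : ℝ) (j : ℕ) : 0 ≤ chiN x j := by
  unfold chiN; split_ifs <;> norm_num

lemma sum_chiN_le (x : ℝ) (S : Finset ℕ) : ∑ j ∈ S, chiN x j ≤ 1 := by
  unfold chiN
  rw [← Finset.sum_filter]
  simp only [Finset.sum_const, nsmul_eq_mul, mul_one]
  have : (S.filter (fun j : ℕ => |x - j| ≤ 1 / 10)).card ≤ 1 := by
    rw [Finset.card_le_one]
    intro a ha b hb
    simp only [Finset.mem_filter] at ha hb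
    have h1 := abs_le.1 ha.2
    have h2 := abs_le.1 hb.2
    have h3 : (a : ℝ) < b + 1 := by linarith
    have h4 : (b : ℝ) < a + 1 := by linarith
    have h5 : a < b + 1 := by exact_mod_cast h3
    have h6 : b < a + 1 := by exact_mod_cast h4
    omega
  exact_mod_cast this

lemma sum_abs_phi_le (ϕ : ℝ → ℝ) (hs : ∀ x : ℝ, ϕ x ≠ 0 → |x| ≤ 1 / 10) (M : ℝ)
    (hM : ∀ x, |ϕ x| ≤ M) (x : ℝ) (S : Finset ℕ) : ∑ j ∈ S, |ϕ (x - j)| ≤ M := by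
  have hM0 : 0 ≤ M := (abs_nonneg _).trans (hM 0)
  have : ∀ j ∈ S, |ϕ (x - j)| ≤ M * chiN x j := by
    intro j _
    unfold chiN
    split_ifs with h
    · simpa using hM _
    · have : ϕ (x - j) = 0 := by
        by_contra h'
        exact h (hs _ h')
      simp [this]
  refine (Finset.sum_le_sum this).trans ?_
  rw [← Finset.mul_sum]
  have := sum_chiN_le x S
  nlinarith

lemma sum_abs_phi_sub_le (ϕ : ℝ → ℝ) (hs : ∀ x : ℝ, ϕ x ≠ 0 → |x| ≤ 1 / 10) (L : ℝ)
    (hL0 : 0 ≤ L) (hL : ∀ x y, |ϕ x - ϕ y| ≤ L * |x - y|) (x y : ℝ) (S : Finset ℕ) :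
    ∑ j ∈ S, |ϕ (x - j) - ϕ (y - j)| ≤ 2 * L * |x - y| := by
  have hxy : 0 ≤ L * |x - y| := mul_nonneg hL0 (abs_nonneg _)
  have : ∀ j ∈ S, |ϕ (x - j) - ϕ (y - j)| ≤ (L * |x - y|) * (chiN x j + chiN y j) := by
    intro j _
    have h0 : |ϕ (x - j) - ϕ (y - j)| ≤ L * |x - y| := by
      have := hL (x - j) (y - j)
      rwa [sub_sub_sub_cancel_right] at this
    have h1 := chiN_nonneg x j
    have h2 := chiN_nonneg y j
    by_cases hx : |x - j| ≤ 1 / 10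
    · have : chiN x j = 1 := by simp only [chiN, if_pos hx]
      nlinarith
    by_cases hy : |y - j| ≤ 1 / 10
    · have : chiN y j = 1 := by simp only [chiN, if_pos hy]
      nlinarith
    have e1 : ϕ (x - j) = 0 := by
      by_contra h'
      exact hx (hs _ h')
    have e2 : ϕ (y - j) = 0 := by
      by_contra h'
      exact hy (hs _ h')
    simp only [e1, e2, sub_self, abs_zero]
    positivity
  refine (Finset.sum_le_sum this).trans ?_
  rw [← Finset.mul_sum, Finset.sum_add_distrib]
  have h1 := sum_chiN_le x S
  have h2 := sum_chiN_le y S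
  nlinarith

/-- The box containing all supports. -/
def boxB : Set (ℝ × ℝ) := Set.Icc 0 2 ×ˢ Set.Icc 0 2

lemma abs_coeff_le (N : ℕ) (ε : ℕ → ℕ → ℝ) (hε : ∀ j k, ε j k = 1 ∨ ε j k = -1) (j k : ℕ) :
    |ε j k * cN N (j + k)| ≤ 1 := by
  unfold cN
  rcases hε j k with h | h <;> rw [h] <;> split_ifs <;> simp

lemma sigmaN_bound (ϕ : ℝ → ℝ) (hs : ∀ x : ℝ, ϕ x ≠ 0 → |x| ≤ 1 / 10) (M : ℝ)
    (hM : ∀ x, |ϕ x| ≤ M) (N : ℕ) (ε : ℕ → ℕ → ℝ) (hε : ∀ j k, ε j k = 1 ∨ ε j k = -1)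
    (ξ : ℝ × ℝ) : ‖sigmaN ϕ N ε ξ‖ ≤ M * M := by
  have hM0 : 0 ≤ M := (abs_nonneg _).trans (hM 0)
  unfold sigmaN
  rw [Complex.norm_real, Real.norm_eq_abs]
  calc _ ≤ ∑ j ∈ Finset.Icc 1 N, ∑ k ∈ Finset.Icc 1 N,
        |ϕ ((N : ℝ) * ξ.1 - j)| * |ϕ ((N : ℝ) * ξ.2 - k)| := by
        refine (Finset.abs_sum_le_sum_abs _ _).trans (Finset.sum_le_sum fun j _ => ?_)
        refine (Finset.abs_sum_le_sum_abs _ _).trans (Finset.sum_le_sum fun k _ => ?_)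
        rw [mul_assoc, abs_mul, abs_mul (ϕ _)]
        exact mul_le_of_le_one_left (by positivity) (abs_coeff_le N ε hε j k)
    _ = (∑ j ∈ Finset.Icc 1 N, |ϕ ((N : ℝ) * ξ.1 - j)|) *
        ∑ k ∈ Finset.Icc 1 N, |ϕ ((N : ℝ) * ξ.2 - k)| := by rw [Finset.sum_mul_sum]
    _ ≤ M * M := by
        gcongr <;> exact sum_abs_phi_le ϕ hs M hM _ _

lemma sigmaN_lip (ϕ : ℝ → ℝ) (hs : ∀ x : ℝ, ϕ x ≠ 0 → |x| ≤ 1 / 10) (M L : ℝ)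
    (hM : ∀ x, |ϕ x| ≤ M) (hL0 : 0 ≤ L) (hL : ∀ x y, |ϕ x - ϕ y| ≤ L * |x - y|)
    (N : ℕ) (ε : ℕ → ℕ → ℝ) (hε : ∀ j k, ε j k = 1 ∨ ε j k = -1)
    (ξ η : ℝ × ℝ) : ‖sigmaN ϕ N ε ξ - sigmaN ϕ N ε η‖ ≤ 4 * L * M * (N * ‖ξ - η‖) := by
  have hM0 : 0 ≤ M := (abs_nonneg _).trans (hM 0)
  unfold sigmaN
  rw [← Complex.ofReal_sub, Complex.norm_real, Real.norm_eq_abs, ← Finset.sum_sub_distrib]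
  simp_rw [← Finset.sum_sub_distrib]
  calc _ ≤ ∑ j ∈ Finset.Icc 1 N, ∑ k ∈ Finset.Icc 1 N,
        (|ϕ ((N : ℝ) * ξ.1 - j) - ϕ ((N : ℝ) * η.1 - j)| * |ϕ ((N : ℝ) * ξ.2 - k)| +
        |ϕ ((N : ℝ) * η.1 - j)| * |ϕ ((N : ℝ) * ξ.2 - k) - ϕ ((N : ℝ) * η.2 - k)|) := by
        refine (Finset.abs_sum_le_sum_abs _ _).trans (Finset.sum_le_sum fun j _ => ?_)
        refine (Finset.abs_sum_le_sum_abs _ _).trans (Finset.sum_le_sum fun k _ => ?_)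
        rw [← abs_mul, ← abs_mul]
        refine le_trans ?_ (abs_add_le _ _)
        rw [mul_assoc (ε j k * _), mul_assoc (ε j k * _), ← mul_sub, abs_mul]
        refine (mul_le_of_le_one_left (by positivity) (abs_coeff_le N ε hε j k)).trans ?_
        apply le_of_eq
        congr 1
        ring
    _ = (∑ j ∈ Finset.Icc 1 N, |ϕ ((N : ℝ) * ξ.1 - j) - ϕ ((N : ℝ) * η.1 - j)|) *
        (∑ k ∈ Finset.Icc 1 N, |ϕ ((N : ℝ) * ξ.2 - k)|) +
        (∑ j ∈ Finset.Icc 1 N, |ϕ ((N : ℝ) * η.1 - j)|) *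
        ∑ k ∈ Finset.Icc 1 N, |ϕ ((N : ℝ) * ξ.2 - k) - ϕ ((N : ℝ) * η.2 - k)| := by
        rw [Finset.sum_mul_sum, Finset.sum_mul_sum, ← Finset.sum_add_distrib]
        simp_rw [← Finset.sum_add_distrib]
    _ ≤ (2 * L * |(N : ℝ) * ξ.1 - N * η.1|) * M + M * (2 * L * |(N : ℝ) * ξ.2 - N * η.2|) := by
        have a1 := sum_abs_phi_sub_le ϕ hs L hL0 hL ((N : ℝ) * ξ.1) (N * η.1) (Finset.Icc 1 N)
        have a2 := sum_abs_phi_sub_le ϕ hs L hL0 hL ((N : ℝ) * ξ.2) (N * η.2) (Finset.Icc 1 N)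
        have a3 := sum_abs_phi_le ϕ hs M hM ((N : ℝ) * ξ.2) (Finset.Icc 1 N)
        have a4 := sum_abs_phi_le ϕ hs M hM ((N : ℝ) * η.1) (Finset.Icc 1 N)
        gcongr
    _ ≤ 4 * L * M * (N * ‖ξ - η‖) := by
        have b1 : |ξ.1 - η.1| ≤ ‖ξ - η‖ := by
          simpa using norm_fst_le (ξ - η)
        have b2 : |ξ.2 - η.2| ≤ ‖ξ - η‖ := by
          simpa using norm_snd_le (ξ - η)
        have hN : (0 : ℝ) ≤ N := Nat.cast_nonneg N
        rw [← mul_sub, ← mul_sub, abs_mul, abs_mul, Nat.abs_cast]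
        have c1 : 2 * L * (N * |ξ.1 - η.1|) * M ≤ 2 * L * (N * ‖ξ - η‖) * M := by gcongr
        have c2 : M * (2 * L * (N * |ξ.2 - η.2|)) ≤ M * (2 * L * (N * ‖ξ - η‖)) := by gcongr
        linarith

lemma sigmaN_supp (ϕ : ℝ → ℝ) (hs : ∀ x : ℝ, ϕ x ≠ 0 → |x| ≤ 1 / 10)
    (N : ℕ) (hN : 1 ≤ N) (ε : ℕ → ℕ → ℝ) (ξ : ℝ × ℝ) (hξ : ξ ∉ boxB) :
    sigmaN ϕ N ε ξ = 0 := by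
  unfold sigmaN
  rw [Complex.ofReal_eq_zero]
  refine Finset.sum_eq_zero fun j hj => Finset.sum_eq_zero fun k hk => ?_
  by_contra h
  have h2 : ϕ ((N : ℝ) * ξ.2 - k) ≠ 0 := fun h' => h (by rw [h', mul_zero])
  have h1 : ϕ ((N : ℝ) * ξ.1 - j) ≠ 0 := fun h' => h (by rw [h', mul_zero, zero_mul])
  apply hξ
  have key : ∀ (x : ℝ) (j : ℕ), j ∈ Finset.Icc 1 N → ϕ ((N : ℝ) * x - j) ≠ 0 →
      x ∈ Set.Icc (0 : ℝ) 2 := by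
    intro x j hj h
    have := abs_le.1 (hs _ h)
    rw [Finset.mem_Icc] at hj
    have hj1 : (1 : ℝ) ≤ j := by exact_mod_cast hj.1
    have hj2 : (j : ℝ) ≤ N := by exact_mod_cast hj.2
    have hN' : (1 : ℝ) ≤ N := by exact_mod_cast hN
    constructor <;> nlinarith
  exact ⟨key _ _ hj h1, key _ _ hk h2⟩

open Set in
lemma scaling_integral (a : ℝ) (f : ℝ → ℝ) (b : ℝ) (hb : 0 < b) :
    ∫ t in Ioi (0 : ℝ), t ^ (-1 - a) * f (b * t) = b ^ a * ∫ t in Ioi (0 : ℝ), t ^ (-1 - a) * f t := by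
  have h := integral_comp_mul_left_Ioi (fun t : ℝ => t ^ (-1 - a) * f t) 0 hb
  rw [mul_zero, smul_eq_mul] at h
  have h2 : ∫ t in Ioi (0 : ℝ), (b * t) ^ (-1 - a) * f (b * t) =
      b ^ (-1 - a) * ∫ t in Ioi (0 : ℝ), t ^ (-1 - a) * f (b * t) := by
    rw [← integral_const_mul]
    refine setIntegral_congr_fun measurableSet_Ioi fun t ht => ?_
    rw [Real.mul_rpow hb.le (le_of_lt ht)]
    ring
  rw [h2] at h
  have h3 : b ^ (-1 - a) = b⁻¹ * (b ^ a)⁻¹ := by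
    rw [Real.rpow_sub hb, Real.rpow_neg_one]; rfl
  rw [h3] at h
  have h4 : b ^ a ≠ 0 := (Real.rpow_pos_of_pos hb a).ne'
  field_simp at h
  linarith

open Set in
lemma scaling_integrable (a : ℝ) (f : ℝ → ℝ) (b : ℝ) (hb : 0 < b)
    (hf : IntegrableOn (fun t : ℝ => t ^ (-1 - a) * f t) (Ioi 0)) :
    IntegrableOn (fun t : ℝ => t ^ (-1 - a) * f (b * t)) (Ioi 0) := by
  have h := (integrableOn_Ioi_comp_mul_left_iff (fun t : ℝ => t ^ (-1 - a) * f t) 0 hb).2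
    (by rwa [mul_zero])
  have h2 := h.const_mul (b ^ (-1 - a))⁻¹
  refine (integrableOn_congr_fun (fun t ht => ?_) measurableSet_Ioi).1 h2
  have h4 : b ^ (-1 - a) ≠ 0 := (Real.rpow_pos_of_pos hb _).ne'
  rw [Real.mul_rpow hb.le (le_of_lt ht)]
  field_simp

/-- `min 1 √t`. -/
def mm (t : ℝ) : ℝ := min 1 (Real.sqrt t)

lemma mm_nonneg (t : ℝ) : 0 ≤ mm t := le_min zero_le_one (Real.sqrt_nonneg _)

lemma mm_continuous : Continuous mm := by unfold mm; fun_prop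

open Set in
lemma mm_integrable (a : ℝ) (h0 : 0 < a) (h1 : a < 1 / 2) :
    IntegrableOn (fun t : ℝ => t ^ (-1 - a) * mm t) (Ioi 0) := by
  have hmeas : Measurable (fun t : ℝ => t ^ (-1 - a) * mm t) :=
    (by fun_prop : Measurable (fun t : ℝ => t ^ (-1 - a))).mul mm_continuous.measurable
  rw [← Ioc_union_Ioi_eq_Ioi (zero_le_one : (0 : ℝ) ≤ 1)]
  refine IntegrableOn.union ?_ ?_
  · have h := (intervalIntegral.intervalIntegrable_rpow' (a := 0) (b := 1)
      (show (-1 : ℝ) < -1 / 2 - a by linarith)).1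
    refine Integrable.mono' h hmeas.aestronglyMeasurable ?_
    refine (ae_restrict_iff' measurableSet_Ioc).2 (Filter.Eventually.of_forall fun t ht => ?_)
    have h3 : 0 ≤ t ^ (-1 - a) := Real.rpow_nonneg ht.1.le _
    rw [Real.norm_of_nonneg (mul_nonneg h3 (mm_nonneg t))]
    calc t ^ (-1 - a) * mm t ≤ t ^ (-1 - a) * Real.sqrt t := by
          gcongr; exact min_le_right _ _
      _ = t ^ (-1 / 2 - a) := by
          rw [Real.sqrt_eq_rpow, ← Real.rpow_add ht.1]; congr 1; ring
  · have h := integrableOn_Ioi_rpow_of_lt (show -1 - a < -1 by linarith) (zero_lt_one)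
    refine Integrable.mono' h hmeas.aestronglyMeasurable ?_
    refine (ae_restrict_iff' measurableSet_Ioi).2 (Filter.Eventually.of_forall fun t ht => ?_)
    have ht0 : 0 < t := lt_trans zero_lt_one ht
    have h3 : 0 ≤ t ^ (-1 - a) := Real.rpow_nonneg ht0.le _
    rw [Real.norm_of_nonneg (mul_nonneg h3 (mm_nonneg t))]
    exact mul_le_of_le_one_right h3 (min_le_left _ _)

lemma one_sub_exp_le_mm (t : ℝ) (ht : 0 ≤ t) : 1 - Real.exp (-t) ≤ mm t := by
  have h1 : 1 - Real.exp (-t) ≤ 1 := by linarith [Real.exp_pos (-t)]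
  refine le_min h1 ?_
  have h2 : 1 - Real.exp (-t) ≤ t := by linarith [Real.add_one_le_exp (-t)]
  by_cases h : t ≤ 1
  · refine h2.trans (Real.le_sqrt_of_sq_le ?_)
    nlinarith
  · refine h1.trans (Real.le_sqrt_of_sq_le ?_)
    linarith

open Set in
lemma exp_integrable (a : ℝ) (h0 : 0 < a) (h1 : a < 1 / 2) :
    IntegrableOn (fun t : ℝ => t ^ (-1 - a) * (1 - Real.exp (-t))) (Ioi 0) := by
  refine Integrable.mono' (mm_integrable a h0 h1) (by fun_prop) ?_
  refine (ae_restrict_iff' measurableSet_Ioi).2 (Filter.Eventually.of_forall fun t ht => ?_)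
  have ht0 : 0 < t := ht
  have h3 : 0 ≤ t ^ (-1 - a) := Real.rpow_nonneg ht0.le _
  have h4 : 0 ≤ 1 - Real.exp (-t) := by
    have : Real.exp (-t) ≤ 1 := Real.exp_le_one_iff.2 (by linarith)
    linarith
  rw [Real.norm_of_nonneg (mul_nonneg h3 h4)]
  gcongr
  exact one_sub_exp_le_mm t ht0.le

/-- The normalising constant. -/
def cBern (a : ℝ) : ℝ := ∫ t in Set.Ioi (0 : ℝ), t ^ (-1 - a) * (1 - Real.exp (-t))

open Set in
lemma cBern_pos (a : ℝ) (h0 : 0 < a) (h1 : a < 1 / 2) : 0 < cBern a := by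
  unfold cBern
  have hpos : ∀ t ∈ Ioi (0 : ℝ), 0 < t ^ (-1 - a) * (1 - Real.exp (-t)) := by
    intro t ht
    have ht0 : 0 < t := ht
    have : Real.exp (-t) < 1 := Real.exp_lt_one_iff.2 (by linarith)
    exact mul_pos (Real.rpow_pos_of_pos ht0 _) (by linarith)
  rw [setIntegral_pos_iff_support_of_nonneg_ae _ (exp_integrable a h0 h1)]
  · have : (Function.support fun t : ℝ => t ^ (-1 - a) * (1 - Real.exp (-t))) ∩ Ioi 0 = Ioi 0 := by
      refine inter_eq_right.2 fun t ht => (hpos t ht).ne'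
    rw [this]; simp
  · exact (ae_restrict_iff' measurableSet_Ioi).2
      (Filter.Eventually.of_forall fun t ht => (hpos t ht).le)

/-- The Gaussian. -/
def GG (w : ℝ × ℝ) : ℝ := (1 / (4 * Real.pi)) * Real.exp (-(w.1 ^ 2 + w.2 ^ 2) / 4)

/-- The symbol of `1 - Δ`. -/
def lam (ζ : ℝ × ℝ) : ℝ := 1 + 4 * Real.pi ^ 2 * (ζ.1 ^ 2 + ζ.2 ^ 2)

lemma one_le_lam (ζ : ℝ × ℝ) : 1 ≤ lam ζ := by
  unfold lam
  have : 0 ≤ 4 * Real.pi ^ 2 * (ζ.1 ^ 2 + ζ.2 ^ 2) := by positivity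
  linarith

lemma lam_continuous : Continuous lam := by unfold lam; fun_prop

/-- The character. -/
def ee (y ζ : ℝ × ℝ) : ℂ :=
  Complex.exp ((2 * Real.pi * Complex.I) * ((y.1 * ζ.1 + y.2 * ζ.2 : ℝ) : ℂ))

lemma norm_ee (y ζ : ℝ × ℝ) : ‖ee y ζ‖ = 1 := by
  unfold ee
  rw [show (2 * Real.pi * Complex.I) * ((y.1 * ζ.1 + y.2 * ζ.2 : ℝ) : ℂ) =
    ((2 * Real.pi * (y.1 * ζ.1 + y.2 * ζ.2) : ℝ) : ℂ) * Complex.I by push_cast; ring]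
  exact Complex.norm_exp_ofReal_mul_I _

lemma gauss_1d (t : ℝ) (ht : 0 < t) (z : ℝ) :
    ∫ x : ℝ, Complex.exp (Complex.I * (2 * Real.pi * z : ℂ) * x) *
      Complex.exp (-(4 * Real.pi ^ 2 * t : ℂ) * x ^ 2) =
    (1 / (4 * Real.pi * t) : ℂ) ^ (1 / 2 : ℂ) * Complex.exp (-(z ^ 2 / (4 * t) : ℂ)) := by
  have hpi := Real.pi_pos
  have hb : 0 < (4 * Real.pi ^ 2 * t : ℂ).re := by
    have : (4 * Real.pi ^ 2 * t : ℂ) = ((4 * Real.pi ^ 2 * t : ℝ) : ℂ) := by push_cast; rfl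
    rw [this, Complex.ofReal_re]; positivity
  rw [fourierIntegral_gaussian hb]
  have ht' : (t : ℂ) ≠ 0 := by exact_mod_cast ht.ne'
  have hp' : (Real.pi : ℂ) ≠ 0 := by exact_mod_cast hpi.ne'
  congr 2
  · field_simp
  · field_simp
    ring

lemma exp_lam_integrable (t : ℝ) (ht : 0 < t) :
    Integrable (fun ζ : ℝ × ℝ => Real.exp (-(t * lam ζ))) := by
  have hpi := Real.pi_pos
  have h1 := integrable_exp_neg_mul_sq (show 0 < 4 * Real.pi ^ 2 * t by positivity)
  have h2 := (h1.mul_prod h1).const_mul (Real.exp (-t))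
  refine h2.congr (Filter.Eventually.of_forall fun ζ => ?_)
  simp only [lam]
  rw [← Real.exp_add, ← Real.exp_add]
  congr 1; ring

lemma gauss_2d (t : ℝ) (ht : 0 < t) (z : ℝ × ℝ) :
    ∫ ζ : ℝ × ℝ, ((Real.exp (-(t * lam ζ)) : ℝ) : ℂ) * ee z ζ =
      ((Real.exp (-t) * (1 / (4 * Real.pi * t)) *
        Real.exp (-(z.1 ^ 2 + z.2 ^ 2) / (4 * t)) : ℝ) : ℂ) := by
  have hpi := Real.pi_pos
  have e1 : ∀ ζ : ℝ × ℝ, ((Real.exp (-(t * lam ζ)) : ℝ) : ℂ) * ee z ζ =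
      (Complex.exp (-t)) * ((Complex.exp (Complex.I * (2 * Real.pi * z.1 : ℂ) * ζ.1) *
      Complex.exp (-(4 * Real.pi ^ 2 * t : ℂ) * ζ.1 ^ 2)) *
      (Complex.exp (Complex.I * (2 * Real.pi * z.2 : ℂ) * ζ.2) *
      Complex.exp (-(4 * Real.pi ^ 2 * t : ℂ) * ζ.2 ^ 2))) := by
    intro ζ
    unfold ee lam
    push_cast
    simp only [← Complex.exp_add]
    congr 1; ring
  simp_rw [e1]
  rw [integral_const_mul, Measure.volume_eq_prod, integral_prod_mul
    (fun x : ℝ => Complex.exp (Complex.I * (2 * Real.pi * z.1 : ℂ) * x) *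
      Complex.exp (-(4 * Real.pi ^ 2 * t : ℂ) * x ^ 2))
    (fun x : ℝ => Complex.exp (Complex.I * (2 * Real.pi * z.2 : ℂ) * x) *
      Complex.exp (-(4 * Real.pi ^ 2 * t : ℂ) * x ^ 2)), gauss_1d t ht, gauss_1d t ht]
  have hne : (1 / (4 * Real.pi * t) : ℂ) ≠ 0 := by
    have : ((1 / (4 * Real.pi * t) : ℝ) : ℂ) ≠ 0 := by
      rw [Complex.ofReal_ne_zero]; positivity
    push_cast at this; exact this
  have hsq : (1 / (4 * Real.pi * t) : ℂ) ^ (1 / 2 : ℂ) * (1 / (4 * Real.pi * t) : ℂ) ^ (1 / 2 : ℂ) =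
      (1 / (4 * Real.pi * t) : ℂ) := by
    rw [← Complex.cpow_add _ _ hne]; norm_num
  have hex : Complex.exp (-(z.1 ^ 2 / (4 * t) : ℂ)) * Complex.exp (-(z.2 ^ 2 / (4 * t) : ℂ)) =
      Complex.exp (-(z.1 ^ 2 + z.2 ^ 2) / (4 * t) : ℂ) := by
    rw [← Complex.exp_add]; congr 1; ring
  push_cast
  rw [← hex, mul_mul_mul_comm, hsq]
  ring

lemma GG_pos (w : ℝ × ℝ) : 0 < GG w := by unfold GG; have := Real.pi_pos; positivity

lemma GG_continuous : Continuous GG := by unfold GG; fun_prop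

lemma GG_eq (w : ℝ × ℝ) : GG w = (1 / (4 * Real.pi)) *
    (Real.exp (-(1 / 4) * w.1 ^ 2) * Real.exp (-(1 / 4) * w.2 ^ 2)) := by
  unfold GG; rw [← Real.exp_add]; congr 2; ring

lemma GG_integrable : Integrable GG := by
  have h1 := integrable_exp_neg_mul_sq (show (0 : ℝ) < 1 / 4 by norm_num)
  refine ((h1.mul_prod h1).const_mul (1 / (4 * Real.pi))).congr
    (Filter.Eventually.of_forall fun w => ?_)
  simp only [GG_eq]

lemma GG_integral : ∫ w, GG w = 1 := by
  simp_rw [GG_eq]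
  rw [integral_const_mul, Measure.volume_eq_prod, integral_prod_mul
    (fun x : ℝ => Real.exp (-(1 / 4) * x ^ 2)) (fun x : ℝ => Real.exp (-(1 / 4) * x ^ 2)),
    integral_gaussian, Real.mul_self_sqrt (by positivity)]
  have := Real.pi_pos
  field_simp

lemma GG_norm_integrable : Integrable (fun w : ℝ × ℝ => GG w * (1 + ‖w‖)) := by
  have h1 := integrable_exp_neg_mul_sq (show (0 : ℝ) < 1 / 8 by norm_num)
  refine Integrable.mono' ((h1.mul_prod h1).const_mul (1 / (4 * Real.pi) * 8)) ?_
    (Filter.Eventually.of_forall fun w => ?_)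
  · exact (GG_continuous.mul (by fun_prop)).aestronglyMeasurable
  · have hpi := Real.pi_pos
    rw [Real.norm_of_nonneg (mul_nonneg (GG_pos w).le (by positivity)), GG_eq]
    have hw : 1 + ‖w‖ ≤ 8 * Real.exp ((w.1 ^ 2 + w.2 ^ 2) / 8) := by
      have h3 := Real.add_one_le_exp ((w.1 ^ 2 + w.2 ^ 2) / 8)
      have h4 : ‖w‖ ≤ 1 + w.1 ^ 2 + w.2 ^ 2 := by
        rw [Prod.norm_def]
        refine max_le ?_ ?_
        · rw [Real.norm_eq_abs]
          nlinarith [sq_abs w.1, sq_nonneg (|w.1| - 1), sq_nonneg w.2]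
        · rw [Real.norm_eq_abs]
          nlinarith [sq_abs w.2, sq_nonneg (|w.2| - 1), sq_nonneg w.1]
      linarith
    calc _ ≤ 1 / (4 * Real.pi) * (Real.exp (-(1 / 4) * w.1 ^ 2) * Real.exp (-(1 / 4) * w.2 ^ 2)) *
          (8 * Real.exp ((w.1 ^ 2 + w.2 ^ 2) / 8)) := by gcongr
      _ = 1 / (4 * Real.pi) * 8 * (Real.exp (-(1 / 4) * w.1 ^ 2) * Real.exp (-(1 / 4) * w.2 ^ 2) *
          Real.exp ((w.1 ^ 2 + w.2 ^ 2) / 8)) := by ring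
      _ = _ := by
          simp only [← Real.exp_add]
          congr 2; ring

lemma ee_continuous (y : ℝ × ℝ) : Continuous (ee y) := by unfold ee; fun_prop

lemma ft2r_eq (σ : ℝ × ℝ → ℂ) (ζ : ℝ × ℝ) : ft2r σ ζ = ∫ x, σ x * ee (-x) ζ := by
  unfold ft2r ee
  congr 1; ext x
  congr 2
  simp only [Prod.fst_neg, Prod.snd_neg]
  push_cast; ring

lemma ee_mul (x y ζ : ℝ × ℝ) : ee (-x) ζ * ee y ζ = ee (y - x) ζ := by
  unfold ee
  rw [← Complex.exp_add]
  congr 1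
  simp only [Prod.fst_neg, Prod.snd_neg, Prod.fst_sub, Prod.snd_sub]
  push_cast; ring

/-- The heat semigroup applied to `σ`. -/
def heatE (σ : ℝ × ℝ → ℂ) (t : ℝ) (y : ℝ × ℝ) : ℂ :=
  ((Real.exp (-t) : ℝ) : ℂ) * ∫ w : ℝ × ℝ, ((GG w : ℝ) : ℂ) * σ (y - Real.sqrt t • w)

lemma heat_repr (σ : ℝ × ℝ → ℂ) (hσ : Integrable σ) (t : ℝ) (ht : 0 < t) (y : ℝ × ℝ) :
    ∫ ζ, ((Real.exp (-(t * lam ζ)) : ℝ) : ℂ) * (ft2r σ ζ * ee y ζ) = heatE σ t y := by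
  have hpi := Real.pi_pos
  have h1 : ∀ ζ, ((Real.exp (-(t * lam ζ)) : ℝ) : ℂ) * (ft2r σ ζ * ee y ζ) =
      ∫ x, ((Real.exp (-(t * lam ζ)) : ℝ) : ℂ) * ee (y - x) ζ * σ x := by
    intro ζ
    rw [ft2r_eq, ← integral_mul_const, ← integral_const_mul]
    congr 1; ext x
    rw [← ee_mul]; ring
  simp_rw [h1]
  have hInt : Integrable (Function.uncurry fun (ζ x : ℝ × ℝ) =>
      ((Real.exp (-(t * lam ζ)) : ℝ) : ℂ) * ee (y - x) ζ * σ x) (volume.prod volume) := by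
    have h2 := (exp_lam_integrable t ht).ofReal (𝕜 := ℂ) |>.mul_prod hσ
    refine Integrable.mono h2 ?_ (Filter.Eventually.of_forall fun p => ?_)
    · have h3 : Continuous (fun p : (ℝ × ℝ) × (ℝ × ℝ) => ee (y - p.2) p.1) := by
        unfold ee; fun_prop
      refine (h2.aestronglyMeasurable.mul h3.aestronglyMeasurable).congr
        (Filter.Eventually.of_forall fun p => ?_)
      simp only [Function.uncurry, Pi.mul_apply, RCLike.ofReal_eq_complex_ofReal]
      ring
    · simp only [Function.uncurry, norm_mul, norm_ee, mul_one]
      exact le_rfl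
  rw [integral_integral_swap hInt]
  have h4 : ∀ x, ∫ ζ, ((Real.exp (-(t * lam ζ)) : ℝ) : ℂ) * ee (y - x) ζ * σ x =
      ((Real.exp (-t) * (1 / (4 * Real.pi * t)) *
        Real.exp (-((y - x).1 ^ 2 + (y - x).2 ^ 2) / (4 * t)) : ℝ) : ℂ) * σ (y - (y - x)) := by
    intro x
    rw [integral_mul_const, gauss_2d t ht, sub_sub_cancel]
  simp_rw [h4]
  rw [integral_sub_left_eq_self (fun z : ℝ × ℝ => ((Real.exp (-t) * (1 / (4 * Real.pi * t)) *
        Real.exp (-(z.1 ^ 2 + z.2 ^ 2) / (4 * t)) : ℝ) : ℂ) * σ (y - z)) volume y]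
  have h5 := Measure.integral_comp_smul (volume : Measure (ℝ × ℝ))
    (fun z : ℝ × ℝ => ((Real.exp (-t) * (1 / (4 * Real.pi * t)) *
        Real.exp (-(z.1 ^ 2 + z.2 ^ 2) / (4 * t)) : ℝ) : ℂ) * σ (y - z)) (Real.sqrt t)
  have hfr : Module.finrank ℝ (ℝ × ℝ) = 2 := by simp
  rw [hfr, Real.sq_sqrt ht.le, abs_of_pos (inv_pos.2 ht)] at h5
  have h6 : ∀ A : ℂ, A = t • (t⁻¹ • A) := fun A => by
    rw [smul_smul, mul_inv_cancel₀ ht.ne', one_smul]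
  rw [h6 (∫ z : ℝ × ℝ, _), ← h5, heatE, ← integral_const_mul, ← integral_smul]
  congr 1; ext w
  have hs : Real.sqrt t ^ 2 = t := Real.sq_sqrt ht.le
  have h7 : -((Real.sqrt t • w).1 ^ 2 + (Real.sqrt t • w).2 ^ 2) / (4 * t) =
      -(w.1 ^ 2 + w.2 ^ 2) / 4 := by
    simp only [Prod.smul_fst, Prod.smul_snd, smul_eq_mul, mul_pow, hs]
    field_simp
  rw [h7, Complex.real_smul, ← mul_assoc, ← mul_assoc, ← Complex.ofReal_mul, ← Complex.ofReal_mul]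
  congr 2
  unfold GG
  field_simp

open scoped ENNReal

/-- Indicator of the box. -/
def indB (x : ℝ × ℝ) : ℝ≥0∞ := boxB.indicator 1 x

lemma boxB_meas : MeasurableSet boxB := measurableSet_Icc.prod measurableSet_Icc

lemma indB_meas : Measurable indB := measurable_one.indicator boxB_meas

lemma indB_le (x : ℝ × ℝ) : indB x ≤ 1 := by
  unfold indB; exact Set.indicator_le_self' (by simp) x

/-- Weighted Gaussian. -/
def gw (w : ℝ × ℝ) : ℝ := GG w * (1 + ‖w‖)

lemma gw_nonneg (w : ℝ × ℝ) : 0 ≤ gw w := mul_nonneg (GG_pos w).le (by positivity)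

lemma gw_continuous : Continuous gw := GG_continuous.mul (by fun_prop)

/-- Total mass of the weighted Gaussian. -/
def kG : ℝ := ∫ w, gw w

lemma kG_nonneg : 0 ≤ kG := integral_nonneg gw_nonneg

lemma kG_eq : ∫⁻ w, ENNReal.ofReal (gw w) = ENNReal.ofReal kG :=
  (ofReal_integral_eq_lintegral_ofReal GG_norm_integrable
    (Filter.Eventually.of_forall gw_nonneg)).symm

/-- Auxiliary majorant. -/
def majW (t : ℝ) (y : ℝ × ℝ) : ℝ≥0∞ :=
  ENNReal.ofReal (1 + kG) * indB y + ∫⁻ w, ENNReal.ofReal (gw w) * indB (y - Real.sqrt t • w)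

lemma majW_le (t : ℝ) (y : ℝ × ℝ) : majW t y ≤ ENNReal.ofReal (1 + 2 * kG) := by
  have h : ∫⁻ w, ENNReal.ofReal (gw w) * indB (y - Real.sqrt t • w) ≤ ENNReal.ofReal kG := by
    rw [← kG_eq]
    exact lintegral_mono fun w => mul_le_of_le_one_right' (indB_le _)
  have h2 : ENNReal.ofReal (1 + kG) * indB y ≤ ENNReal.ofReal (1 + kG) :=
    mul_le_of_le_one_right' (indB_le _)
  refine (add_le_add h2 h).trans ?_
  rw [← ENNReal.ofReal_add (by linarith [kG_nonneg]) kG_nonneg]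
  exact ENNReal.ofReal_le_ofReal (by linarith)

lemma majW_meas2 : Measurable (fun p : ℝ × (ℝ × ℝ) => majW p.1 p.2) := by
  unfold majW
  refine (Measurable.const_mul (indB_meas.comp measurable_snd) _).add ?_
  have : Measurable (fun q : (ℝ × (ℝ × ℝ)) × (ℝ × ℝ) =>
      ENNReal.ofReal (gw q.2) * indB (q.1.2 - Real.sqrt q.1.1 • q.2)) := by
    refine (ENNReal.measurable_ofReal.comp (gw_continuous.measurable.comp measurable_snd)).mul
      (indB_meas.comp ?_)
    exact Continuous.measurable (by fun_prop)
  exact this.lintegral_prod_right'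

lemma lintegral_indB : ∫⁻ y, indB y = 4 := by
  unfold indB
  rw [lintegral_indicator_one boxB_meas]
  unfold boxB
  rw [Measure.volume_eq_prod, Measure.prod_prod, Real.volume_Icc, ← ENNReal.ofReal_mul (by norm_num)]
  norm_num

lemma lintegral_majW (t : ℝ) : ∫⁻ y, majW t y ≤ ENNReal.ofReal (1 + 2 * kG) * 4 := by
  unfold majW
  rw [lintegral_add_left (indB_meas.const_mul _), lintegral_const_mul _ indB_meas, lintegral_indB,
    lintegral_lintegral_swap]
  · have h : ∀ w : ℝ × ℝ, ∫⁻ y, ENNReal.ofReal (gw w) * indB (y - Real.sqrt t • w) =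
        ENNReal.ofReal (gw w) * 4 := by
      intro w
      rw [lintegral_const_mul' _ _ ENNReal.ofReal_ne_top,
        lintegral_sub_right_eq_self indB, lintegral_indB]
    simp_rw [h]
    rw [lintegral_mul_const' _ _ (by norm_num), kG_eq, ← add_mul,
      ← ENNReal.ofReal_add (by linarith [kG_nonneg]) kG_nonneg]
    exact le_of_eq (by congr 2; ring)
  · refine Measurable.aemeasurable ?_
    refine (ENNReal.measurable_ofReal.comp (gw_continuous.measurable.comp measurable_snd)).mul
      (indB_meas.comp ?_)
    exact Continuous.measurable (by fun_prop)

lemma heat_diff (σ : ℝ × ℝ → ℂ) (hσc : Continuous σ) (M : ℝ) (N : ℝ) (hN : 1 ≤ N)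
    (hM : ∀ x, ‖σ x‖ ≤ M) (hL : ∀ x y, ‖σ x - σ y‖ ≤ M * (N * ‖x - y‖))
    (hB : ∀ x, x ∉ boxB → σ x = 0) (t : ℝ) (ht : 0 < t) (y : ℝ × ℝ) :
    ‖σ y - heatE σ t y‖ₑ ≤ ENNReal.ofReal (2 * M * mm (N ^ 2 * t)) * majW t y := by
  have hM0 : 0 ≤ M := (norm_nonneg _).trans (hM 0)
  set h := mm (N ^ 2 * t) with hh
  have hh0 : 0 ≤ h := mm_nonneg _
  have hh' : h = min 1 (N * Real.sqrt t) := by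
    rw [hh, mm, Real.sqrt_mul (by positivity), Real.sqrt_sq (by linarith)]
  have hexp1 : Real.exp (-t) ≤ 1 := Real.exp_le_one_iff.2 (by linarith)
  have hGi : ∀ y' : ℝ × ℝ, Integrable (fun w : ℝ × ℝ => ((GG w : ℝ) : ℂ) * σ (y' - Real.sqrt t • w)) := by
    intro y'
    refine Integrable.mono' (GG_integrable.mul_const M) ?_ (Filter.Eventually.of_forall fun w => ?_)
    · exact ((Complex.continuous_ofReal.comp GG_continuous).mul
        (hσc.comp (by fun_prop))).aestronglyMeasurable
    · rw [norm_mul, Complex.norm_real, Real.norm_of_nonneg (GG_pos w).le]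
      exact mul_le_mul_of_nonneg_left (hM _) (GG_pos w).le
  have hGc : Integrable (fun w : ℝ × ℝ => ((GG w : ℝ) : ℂ) * σ y) :=
    (GG_integrable.ofReal (𝕜 := ℂ)).mul_const _
  have hGone : ∫ w : ℝ × ℝ, ((GG w : ℝ) : ℂ) * σ y = σ y := by
    rw [integral_mul_const, integral_complex_ofReal, GG_integral]; simp
  have e1 : σ y - heatE σ t y = ((1 - Real.exp (-t) : ℝ) : ℂ) * σ y +
      ((Real.exp (-t) : ℝ) : ℂ) * ∫ w, ((GG w : ℝ) : ℂ) * (σ y - σ (y - Real.sqrt t • w)) := by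
    simp_rw [mul_sub]
    rw [integral_sub hGc (hGi y), hGone, heatE]
    push_cast; ring
  rw [e1]
  refine (enorm_add_le _ _).trans ?_
  have p1 : ‖((1 - Real.exp (-t) : ℝ) : ℂ) * σ y‖ₑ ≤ ENNReal.ofReal (2 * M * h) * indB y := by
    by_cases hy : y ∈ boxB
    · have : indB y = 1 := by simp [indB, hy]
      rw [this, mul_one, ← ofReal_norm]
      refine ENNReal.ofReal_le_ofReal ?_
      rw [norm_mul, Complex.norm_real, Real.norm_of_nonneg (by linarith)]
      have a1 : 1 - Real.exp (-t) ≤ h := by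
        refine (one_sub_exp_le_mm t ht.le).trans ?_
        rw [hh, mm, mm]
        gcongr
        exact le_mul_of_one_le_left ht.le (one_le_pow₀ hN)
      have a2 := hM y
      calc _ ≤ h * M := by gcongr
        _ ≤ 2 * M * h := by nlinarith [mul_nonneg hh0 hM0]
    · rw [hB y hy]; simp
  have q : ∀ w, ‖σ y - σ (y - Real.sqrt t • w)‖ₑ ≤
      ENNReal.ofReal (2 * M * h * (1 + ‖w‖)) * (indB y + indB (y - Real.sqrt t • w)) := by
    intro w
    have b0 : ‖σ y - σ (y - Real.sqrt t • w)‖ ≤ 2 * M * h * (1 + ‖w‖) := by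
      have b1 : ‖σ y - σ (y - Real.sqrt t • w)‖ ≤ 2 * M := by
        refine (norm_sub_le _ _).trans ?_
        linarith [hM y, hM (y - Real.sqrt t • w)]
      have b2 := hL y (y - Real.sqrt t • w)
      rw [sub_sub_cancel, norm_smul, Real.norm_of_nonneg (Real.sqrt_nonneg t)] at b2
      have hw := norm_nonneg w
      rw [hh']
      have hst := Real.sqrt_nonneg t
      rcases le_total 1 (N * Real.sqrt t) with c | c
      · rw [min_eq_left c]; nlinarith [mul_nonneg hM0 hw]
      · rw [min_eq_right c]
        have : 0 ≤ N * Real.sqrt t := by positivity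
        nlinarith [mul_nonneg hM0 this, mul_nonneg (mul_nonneg hM0 this) hw]
    have b3 : ‖σ y - σ (y - Real.sqrt t • w)‖ₑ ≤ ENNReal.ofReal (2 * M * h * (1 + ‖w‖)) := by
      rw [← ofReal_norm]; exact ENNReal.ofReal_le_ofReal b0
    by_cases hy : y ∈ boxB
    · have : indB y = 1 := by simp [indB, hy]
      rw [this]
      exact b3.trans (le_mul_of_one_le_right' le_self_add)
    by_cases hy2 : (y - Real.sqrt t • w) ∈ boxB
    · have : indB (y - Real.sqrt t • w) = 1 := by simp [indB, hy2]
      rw [this]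
      exact b3.trans (le_mul_of_one_le_right' le_add_self)
    rw [hB _ hy, hB _ hy2]; simp
  have p2 : ‖((Real.exp (-t) : ℝ) : ℂ) * ∫ w, ((GG w : ℝ) : ℂ) * (σ y - σ (y - Real.sqrt t • w))‖ₑ ≤
      ENNReal.ofReal (2 * M * h) * (ENNReal.ofReal kG * indB y +
        ∫⁻ w, ENNReal.ofReal (gw w) * indB (y - Real.sqrt t • w)) := by
    rw [enorm_mul]
    have r1 : ‖((Real.exp (-t) : ℝ) : ℂ)‖ₑ ≤ 1 := by
      rw [← ofReal_norm, Complex.norm_real, Real.norm_of_nonneg (Real.exp_pos _).le]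
      exact ENNReal.ofReal_le_one.2 hexp1
    refine (mul_le_of_le_one_left' r1).trans ?_
    refine (enorm_integral_le_lintegral_enorm _).trans ?_
    rw [← kG_eq, ← lintegral_mul_const' _ _ (ne_top_of_le_ne_top ENNReal.one_ne_top (indB_le y)),
      ← lintegral_add_left (show Measurable (fun w => ENNReal.ofReal (gw w) * indB y) from
        (ENNReal.measurable_ofReal.comp gw_continuous.measurable).mul_const _),
      ← lintegral_const_mul' _ _ ENNReal.ofReal_ne_top]
    refine lintegral_mono fun w => ?_
    rw [enorm_mul]
    have r2 : ‖((GG w : ℝ) : ℂ)‖ₑ = ENNReal.ofReal (GG w) := by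
      rw [← ofReal_norm, Complex.norm_real, Real.norm_of_nonneg (GG_pos w).le]
    rw [r2]
    calc _ ≤ ENNReal.ofReal (GG w) * (ENNReal.ofReal (2 * M * h * (1 + ‖w‖)) *
          (indB y + indB (y - Real.sqrt t • w))) := by gcongr; exact q w
      _ = _ := by
          rw [ENNReal.ofReal_mul (by positivity), gw, ENNReal.ofReal_mul (GG_pos w).le]
          ring
  refine (add_le_add p1 p2).trans (le_of_eq ?_)
  rw [majW, ENNReal.ofReal_add zero_le_one kG_nonneg, ENNReal.ofReal_one]
  ring

lemma ft2r_continuous (σ : ℝ × ℝ → ℂ) (hσ : Integrable σ) : Continuous (ft2r σ) := by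
  have : ft2r σ = fun ζ => ∫ x, σ x * ee (-x) ζ := funext fun ζ => ft2r_eq σ ζ
  rw [this]
  refine continuous_of_dominated (bound := fun x => ‖σ x‖) ?_ ?_ hσ.norm ?_
  · intro ζ
    refine hσ.aestronglyMeasurable.mul (Continuous.aestronglyMeasurable ?_)
    unfold ee; fun_prop
  · intro ζ
    exact Filter.Eventually.of_forall fun x => by rw [norm_mul, norm_ee, mul_one]
  · exact Filter.Eventually.of_forall fun x => continuous_const.mul (ee_continuous _)

lemma inversion (σ : ℝ × ℝ → ℂ) (hσc : Continuous σ) (hσ : Integrable σ) (M : ℝ) (N : ℝ)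
    (hN : 1 ≤ N)
    (hM : ∀ x, ‖σ x‖ ≤ M) (hL : ∀ x y, ‖σ x - σ y‖ ≤ M * (N * ‖x - y‖))
    (hB : ∀ x, x ∉ boxB → σ x = 0) (hft : Integrable (ft2r σ)) (y : ℝ × ℝ) :
    ∫ ζ, ft2r σ ζ * ee y ζ = σ y := by
  have hM0 : 0 ≤ M := (norm_nonneg _).trans (hM 0)
  have hδ : Filter.Tendsto (fun n : ℕ => 1 / ((n : ℝ) + 1)) Filter.atTop (nhds 0) :=
    tendsto_one_div_add_atTop_nhds_zero_nat
  have t1 : Filter.Tendsto (fun n : ℕ => ∫ ζ, ((Real.exp (-((1 / ((n : ℝ) + 1)) * lam ζ)) : ℝ) : ℂ) *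
      (ft2r σ ζ * ee y ζ)) Filter.atTop (nhds (∫ ζ, ft2r σ ζ * ee y ζ)) := by
    refine tendsto_integral_of_dominated_convergence (fun ζ => ‖ft2r σ ζ‖) ?_ hft.norm ?_ ?_
    · intro n
      have c1 := lam_continuous
      have c2 := ee_continuous y
      have c3 := ft2r_continuous σ hσ
      exact Continuous.aestronglyMeasurable (by fun_prop)
    · intro n
      refine Filter.Eventually.of_forall fun ζ => ?_
      rw [norm_mul, norm_mul, norm_ee, mul_one, Complex.norm_real,
        Real.norm_of_nonneg (Real.exp_pos _).le]
      refine mul_le_of_le_one_left (norm_nonneg _) (Real.exp_le_one_iff.2 ?_)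
      have := one_le_lam ζ
      have : 0 ≤ 1 / ((n : ℝ) + 1) * lam ζ := by positivity
      linarith
    · refine Filter.Eventually.of_forall fun ζ => ?_
      have c : Continuous (fun δ : ℝ => ((Real.exp (-(δ * lam ζ)) : ℝ) : ℂ) *
        (ft2r σ ζ * ee y ζ)) := by fun_prop
      have := (c.tendsto 0).comp hδ
      simpa [Function.comp_def] using this
  have t2 : Filter.Tendsto (fun n : ℕ => heatE σ (1 / ((n : ℝ) + 1)) y) Filter.atTop (nhds (σ y)) := by
    rw [tendsto_iff_norm_sub_tendsto_zero]
    have hb : ∀ n : ℕ, ‖heatE σ (1 / ((n : ℝ) + 1)) y - σ y‖ ≤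
        2 * M * mm (N ^ 2 * (1 / ((n : ℝ) + 1))) * (1 + 2 * kG) := by
      intro n
      have hh := heat_diff σ hσc M N hN hM hL hB (1 / ((n : ℝ) + 1)) (by positivity) y
      have h2 := hh.trans (mul_le_mul_right (majW_le _ y) _)
      have h3 := mm_nonneg (N ^ 2 * (1 / ((n : ℝ) + 1)))
      have h4 := kG_nonneg
      rw [← ENNReal.ofReal_mul (by positivity), ← ofReal_norm,
        ENNReal.ofReal_le_ofReal_iff (by positivity)] at h2
      rwa [norm_sub_rev]
    have c : Continuous (fun δ : ℝ => 2 * M * mm (N ^ 2 * δ) * (1 + 2 * kG)) := by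
      have := mm_continuous
      fun_prop
    have lim := (c.tendsto 0).comp hδ
    have hz : 2 * M * mm (N ^ 2 * 0) * (1 + 2 * kG) = 0 := by simp [mm]
    rw [hz] at lim
    exact squeeze_zero (fun n => norm_nonneg _) hb lim
  have heq : (fun n : ℕ => ∫ ζ, ((Real.exp (-((1 / ((n : ℝ) + 1)) * lam ζ)) : ℝ) : ℂ) *
      (ft2r σ ζ * ee y ζ)) = fun n : ℕ => heatE σ (1 / ((n : ℝ) + 1)) y := by
    ext n
    exact heat_repr σ hσ _ (by positivity) y
  rw [heq] at t1
  exact tendsto_nhds_unique t1 t2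

lemma Jneg2_eq (s : ℝ) (σ : ℝ × ℝ → ℂ) (y : ℝ × ℝ) :
    Jneg2 s σ y = ∫ ζ, ((lam ζ ^ (s / 2) : ℝ) : ℂ) * (ft2r σ ζ * ee y ζ) := by
  unfold Jneg2 lam ee
  congr 1; ext ζ
  ring

lemma bern_formula (a : ℝ) (h0 : 0 < a) (h1 : a < 1 / 2) (b : ℝ) (hb : 0 < b) :
    b ^ a = (cBern a)⁻¹ * ∫ t in Set.Ioi (0 : ℝ), t ^ (-1 - a) * (1 - Real.exp (-(t * b))) := by
  have h := scaling_integral a (fun t => 1 - Real.exp (-t)) b hb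
  simp_rw [mul_comm b] at h
  rw [h, show ∫ t in Set.Ioi (0 : ℝ), t ^ (-1 - a) * (1 - Real.exp (-t)) = cBern a from rfl]
  have := (cBern_pos a h0 h1).ne'
  field_simp

lemma bern_integrable (a : ℝ) (h0 : 0 < a) (h1 : a < 1 / 2) (b : ℝ) (hb : 0 < b) :
    IntegrableOn (fun t : ℝ => t ^ (-1 - a) * (1 - Real.exp (-(t * b)))) (Set.Ioi 0) := by
  have h := scaling_integrable a (fun t => 1 - Real.exp (-t)) b hb (exp_integrable a h0 h1)
  simp_rw [mul_comm b] at h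
  exact h

lemma J_pointwise (s : ℝ) (hs0 : 0 < s) (hs1 : s < 1) (σ : ℝ × ℝ → ℂ) (hσc : Continuous σ)
    (hσ : Integrable σ) (M : ℝ) (N : ℝ) (hN : 1 ≤ N)
    (hM : ∀ x, ‖σ x‖ ≤ M) (hL : ∀ x y, ‖σ x - σ y‖ ≤ M * (N * ‖x - y‖))
    (hB : ∀ x, x ∉ boxB → σ x = 0) (y : ℝ × ℝ) :
    ‖Jneg2 s σ y‖ₑ ≤ ENNReal.ofReal (cBern (s / 2))⁻¹ * ∫⁻ t in Set.Ioi (0 : ℝ),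
      ENNReal.ofReal (t ^ (-1 - s / 2)) *
        (ENNReal.ofReal (2 * M * mm (N ^ 2 * t)) * majW t y) := by
  rw [Jneg2_eq]
  by_cases hInt : Integrable (fun ζ => ((lam ζ ^ (s / 2) : ℝ) : ℂ) * (ft2r σ ζ * ee y ζ))
  swap
  · rw [integral_undef hInt]; simp
  set a := s / 2 with ha
  have ha0 : 0 < a := by positivity
  have ha1 : a < 1 / 2 := by rw [ha]; linarith
  have hc := cBern_pos a ha0 ha1
  have cf := ft2r_continuous σ hσ
  have ce := ee_continuous y
  have cl := lam_continuous
  have hlp : ∀ ζ, 0 < lam ζ := fun ζ => lt_of_lt_of_le one_pos (one_le_lam ζ)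
  have hft : Integrable (ft2r σ) := by
    refine Integrable.mono hInt cf.aestronglyMeasurable (Filter.Eventually.of_forall fun ζ => ?_)
    rw [norm_mul, norm_mul, norm_ee, mul_one, Complex.norm_real,
      Real.norm_of_nonneg (Real.rpow_nonneg (hlp ζ).le _)]
    exact le_mul_of_one_le_left (norm_nonneg _) (Real.one_le_rpow (one_le_lam ζ) ha0.le)
  have hfe : Integrable (fun ζ => ft2r σ ζ * ee y ζ) := by
    refine Integrable.mono hft (cf.mul ce).aestronglyMeasurable
      (Filter.Eventually.of_forall fun ζ => ?_)
    rw [norm_mul, norm_ee, mul_one]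
  have hnn : ∀ ζ, ∀ t ∈ Set.Ioi (0 : ℝ), 0 ≤ t ^ (-1 - a) * (1 - Real.exp (-(t * lam ζ))) := by
    intro ζ t ht
    have ht0 : 0 < t := ht
    have : Real.exp (-(t * lam ζ)) ≤ 1 :=
      Real.exp_le_one_iff.2 (by have := mul_pos ht0 (hlp ζ); linarith)
    exact mul_nonneg (Real.rpow_nonneg ht0.le _) (by linarith)
  have e1 : ∀ ζ, ((lam ζ ^ a : ℝ) : ℂ) * (ft2r σ ζ * ee y ζ) =
      (((cBern a)⁻¹ : ℝ) : ℂ) * ∫ t in Set.Ioi (0 : ℝ),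
        ((t ^ (-1 - a) * (1 - Real.exp (-(t * lam ζ))) : ℝ) : ℂ) * (ft2r σ ζ * ee y ζ) := by
    intro ζ
    rw [integral_mul_const, integral_complex_ofReal, bern_formula a ha0 ha1 (lam ζ) (hlp ζ)]
    push_cast; ring
  have hprod : Integrable (Function.uncurry fun (ζ : ℝ × ℝ) (t : ℝ) =>
      ((t ^ (-1 - a) * (1 - Real.exp (-(t * lam ζ))) : ℝ) : ℂ) * (ft2r σ ζ * ee y ζ))
      (volume.prod (volume.restrict (Set.Ioi 0))) := by
    have hmeas : Measurable (Function.uncurry fun (ζ : ℝ × ℝ) (t : ℝ) =>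
      ((t ^ (-1 - a) * (1 - Real.exp (-(t * lam ζ))) : ℝ) : ℂ) * (ft2r σ ζ * ee y ζ)) := by
      have m1 := cf.measurable
      have m2 := ce.measurable
      have m3 := cl.measurable
      unfold Function.uncurry
      fun_prop
    refine (integrable_prod_iff hmeas.aestronglyMeasurable).2 ⟨?_, ?_⟩
    · refine Filter.Eventually.of_forall fun ζ => ?_
      exact ((bern_integrable a ha0 ha1 (lam ζ) (hlp ζ)).ofReal (𝕜 := ℂ)).mul_const
        (ft2r σ ζ * ee y ζ)
    · refine (hInt.norm.const_mul (cBern a)).congr (Filter.Eventually.of_forall fun ζ => ?_)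
      simp only [Function.uncurry]
      have : ∫ t in Set.Ioi (0 : ℝ), ‖((t ^ (-1 - a) * (1 - Real.exp (-(t * lam ζ))) : ℝ) : ℂ) *
          (ft2r σ ζ * ee y ζ)‖ = ∫ t in Set.Ioi (0 : ℝ),
          t ^ (-1 - a) * (1 - Real.exp (-(t * lam ζ))) * ‖ft2r σ ζ * ee y ζ‖ := by
        refine setIntegral_congr_fun measurableSet_Ioi fun t ht => ?_
        rw [norm_mul, Complex.norm_real, Real.norm_of_nonneg (hnn ζ t ht)]
      rw [this, integral_mul_const, norm_mul, Complex.norm_real,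
        Real.norm_of_nonneg (Real.rpow_nonneg (hlp ζ).le _), bern_formula a ha0 ha1 (lam ζ) (hlp ζ),
        ← mul_assoc, ← mul_assoc, mul_inv_cancel₀ hc.ne', one_mul]
  simp_rw [e1]
  rw [integral_const_mul, integral_integral_swap hprod, enorm_mul]
  have r1 : ‖(((cBern a)⁻¹ : ℝ) : ℂ)‖ₑ = ENNReal.ofReal (cBern a)⁻¹ := by
    rw [← ofReal_norm, Complex.norm_real, Real.norm_of_nonneg (inv_pos.2 hc).le]
  rw [r1]
  gcongr
  refine (enorm_integral_le_lintegral_enorm _).trans ?_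
  refine setLIntegral_mono' measurableSet_Ioi fun t ht => ?_
  have ht0 : 0 < t := ht
  have e2 : ∫ ζ, ((t ^ (-1 - a) * (1 - Real.exp (-(t * lam ζ))) : ℝ) : ℂ) * (ft2r σ ζ * ee y ζ) =
      ((t ^ (-1 - a) : ℝ) : ℂ) * (σ y - heatE σ t y) := by
    rw [← inversion σ hσc hσ M N hN hM hL hB hft y, ← heat_repr σ hσ t ht0 y,
      ← integral_sub hfe, ← integral_const_mul]
    · congr 1; ext ζ
      push_cast; ring
    · refine Integrable.mono hfe ?_ (Filter.Eventually.of_forall fun ζ => ?_)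
      · exact Continuous.aestronglyMeasurable (by fun_prop)
      · rw [norm_mul, Complex.norm_real, Real.norm_of_nonneg (Real.exp_pos _).le]
        exact mul_le_of_le_one_left (norm_nonneg _)
          (Real.exp_le_one_iff.2 (by have := mul_pos ht0 (hlp ζ); linarith))
  rw [e2, enorm_mul]
  have r2 : ‖((t ^ (-1 - a) : ℝ) : ℂ)‖ₑ = ENNReal.ofReal (t ^ (-1 - a)) := by
    rw [← ofReal_norm, Complex.norm_real, Real.norm_of_nonneg (Real.rpow_nonneg ht0.le _)]
  rw [r2]
  gcongr
  exact heat_diff σ hσc M N hN hM hL hB t ht0 y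

/-- The base constant. -/
def kM (a : ℝ) : ℝ := ∫ t in Set.Ioi (0 : ℝ), t ^ (-1 - a) * mm t

lemma kM_nonneg (a : ℝ) : 0 ≤ kM a :=
  setIntegral_nonneg measurableSet_Ioi fun t ht =>
    mul_nonneg (Real.rpow_nonneg (le_of_lt ht) _) (mm_nonneg t)

lemma lint_mm (s : ℝ) (hs0 : 0 < s) (hs1 : s < 1) (N : ℝ) (hN : 1 ≤ N) (M : ℝ) (hM0 : 0 ≤ M) :
    ∫⁻ t in Set.Ioi (0 : ℝ), ENNReal.ofReal (t ^ (-1 - s / 2)) *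
      ENNReal.ofReal (2 * M * mm (N ^ 2 * t)) = ENNReal.ofReal (2 * M * kM (s / 2) * N ^ s) := by
  have hN2 : 0 < N ^ 2 := by positivity
  have h1 := scaling_integrable (s / 2) mm (N ^ 2) hN2 (mm_integrable _ (by positivity) (by linarith))
  have h2 := scaling_integral (s / 2) mm (N ^ 2) hN2
  have h3 : (N ^ 2) ^ (s / 2) = N ^ s := by
    rw [← Real.rpow_natCast, ← Real.rpow_mul (by linarith)]; congr 1; push_cast; ring
  rw [h3] at h2
  have h4 : 2 * M * kM (s / 2) * N ^ s =
      ∫ t in Set.Ioi (0 : ℝ), 2 * M * (t ^ (-1 - s / 2) * mm (N ^ 2 * t)) := by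
    rw [integral_const_mul, h2, kM]; ring
  rw [h4, ofReal_integral_eq_lintegral_ofReal (h1.const_mul _)]
  · refine setLIntegral_congr_fun measurableSet_Ioi fun t ht => ?_
    have : 0 ≤ t ^ (-1 - s / 2) := Real.rpow_nonneg (le_of_lt ht) _
    rw [← ENNReal.ofReal_mul this]
    congr 1; ring
  · refine (ae_restrict_iff' measurableSet_Ioi).2 (Filter.Eventually.of_forall fun t ht => ?_)
    have h5 : 0 ≤ t ^ (-1 - s / 2) := Real.rpow_nonneg (le_of_lt ht) _
    have h6 := mm_nonneg (N ^ 2 * t)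
    simp only [Pi.zero_apply]
    positivity

lemma J_Lr (s r : ℝ) (hs0 : 0 < s) (hs1 : s < 1) (hr : 1 < r) (σ : ℝ × ℝ → ℂ)
    (hσc : Continuous σ)
    (hσ : Integrable σ) (M : ℝ) (N : ℝ) (hN : 1 ≤ N)
    (hM : ∀ x, ‖σ x‖ ≤ M) (hL : ∀ x y, ‖σ x - σ y‖ ≤ M * (N * ‖x - y‖))
    (hB : ∀ x, x ∉ boxB → σ x = 0) :
    eLpNorm (Jneg2 s σ) (ENNReal.ofReal r) volume ≤
      ENNReal.ofReal (((cBern (s / 2))⁻¹ * (2 * M * kM (s / 2)) * ((1 + 2 * kG) * 4)) * N ^ s) := by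
  have hM0 : 0 ≤ M := (norm_nonneg _).trans (hM 0)
  have hc := cBern_pos (s / 2) (by positivity) (by linarith)
  have hk := kG_nonneg
  have hkM := kM_nonneg (s / 2)
  have hNs : 0 ≤ N ^ s := Real.rpow_nonneg (by linarith) _
  set R := ENNReal.ofReal
    (((cBern (s / 2))⁻¹ * (2 * M * kM (s / 2)) * ((1 + 2 * kG) * 4)) * N ^ s) with hR
  have hRt : R ≠ ∞ := ENNReal.ofReal_ne_top
  have hR' : R = ENNReal.ofReal (cBern (s / 2))⁻¹ *
      (ENNReal.ofReal (2 * M * kM (s / 2) * N ^ s) * (ENNReal.ofReal (1 + 2 * kG) * 4)) := by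
    rw [hR, show (4 : ℝ≥0∞) = ENNReal.ofReal 4 by norm_num, ← ENNReal.ofReal_mul (by positivity),
      ← ENNReal.ofReal_mul (by positivity), ← ENNReal.ofReal_mul (by positivity)]
    congr 1; ring
  set F : ℝ × ℝ → ℝ≥0∞ := fun y => ENNReal.ofReal (cBern (s / 2))⁻¹ * ∫⁻ t in Set.Ioi (0 : ℝ),
      ENNReal.ofReal (t ^ (-1 - s / 2)) *
        (ENNReal.ofReal (2 * M * mm (N ^ 2 * t)) * majW t y) with hF
  have hJF : ∀ y, ‖Jneg2 s σ y‖ₑ ≤ F y := J_pointwise s hs0 hs1 σ hσc hσ M N hN hM hL hB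
  have hF1 : ∀ y, F y ≤ R := by
    intro y
    rw [hR', hF]
    simp only
    gcongr
    rw [← lint_mm s hs0 hs1 N hN M hM0, ← lintegral_mul_const' _ _ (by finiteness)]
    refine lintegral_mono fun t => ?_
    rw [← mul_assoc]
    gcongr
    refine (majW_le t y).trans (le_mul_of_one_le_right' ?_)
    norm_num
  have hF2 : ∫⁻ y, F y ≤ R := by
    rw [hR', hF, lintegral_const_mul' _ _ ENNReal.ofReal_ne_top]
    gcongr
    rw [lintegral_lintegral_swap]
    · rw [← lint_mm s hs0 hs1 N hN M hM0, ← lintegral_mul_const' _ _ (by finiteness)]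
      refine lintegral_mono fun t => ?_
      rw [lintegral_const_mul' _ _ ENNReal.ofReal_ne_top,
        lintegral_const_mul' _ _ ENNReal.ofReal_ne_top, ← mul_assoc]
      gcongr
      exact lintegral_majW t
    · refine Measurable.aemeasurable ?_
      have m1 : Measurable (fun p : (ℝ × ℝ) × ℝ => majW p.2 p.1) := majW_meas2.comp measurable_swap
      have m2 := mm_continuous.measurable
      unfold Function.uncurry
      fun_prop
  have hr0 : 0 < r := by linarith
  rw [eLpNorm_eq_lintegral_rpow_enorm_toReal (by simpa using hr0) ENNReal.ofReal_ne_top,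
    ENNReal.toReal_ofReal hr0.le]
  have key : ∫⁻ y, ‖Jneg2 s σ y‖ₑ ^ r ≤ R ^ r := by
    have hsplit : ∀ x : ℝ≥0∞, x ^ r = x ^ (r - 1) * x := by
      intro x
      conv_rhs => rw [← ENNReal.rpow_one x, ← ENNReal.rpow_mul, one_mul]
      rw [← ENNReal.rpow_add_of_nonneg _ _ (by linarith) zero_le_one, sub_add_cancel]
    calc ∫⁻ y, ‖Jneg2 s σ y‖ₑ ^ r ≤ ∫⁻ y, R ^ (r - 1) * F y := by
          refine lintegral_mono fun y => ?_
          rw [hsplit]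
          have := hJF y
          have h2 := (hJF y).trans (hF1 y)
          gcongr
      _ = R ^ (r - 1) * ∫⁻ y, F y := by
          rw [lintegral_const_mul' _ _ (ENNReal.rpow_ne_top_of_nonneg (by linarith) hRt)]
      _ ≤ R ^ (r - 1) * R := by gcongr
      _ = R ^ r := (hsplit R).symm
  calc _ ≤ (R ^ r) ^ (1 / r) := by gcongr
    _ = R := by
      rw [← ENNReal.rpow_mul, mul_one_div_cancel hr0.ne', ENNReal.rpow_one]

/-- **Lemma 5.2 (Lemma `SN`).** For every `s ∈ (0,1)` and `1 < r < ∞` there is a constant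
`C = C(s,r,ϕ)`, independent of `N` and of the signs `ε_{j,k}`, such that the `L^r_s(ℝ²)`
Sobolev norm of `σ_N` satisfies `‖J_{-s}σ_N‖_{L^r(ℝ²)} ≤ C N^s`. -/
theorem sigmaN_sobolev_bound (ϕ : ℝ → ℝ) (hϕ_smooth : ContDiff ℝ (⊤ : ℕ∞) ϕ)
    (hϕ_supp : ∀ x : ℝ, ϕ x ≠ 0 → |x| ≤ 1 / 10)
    (hϕ_one : ∀ x : ℝ, |x| ≤ 1 / 20 → ϕ x = 1)
    (s r : ℝ) (hs0 : 0 < s) (hs1 : s < 1) (hr : 1 < r) :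
    ∃ C : ℝ, ∀ N : ℕ, 1 ≤ N → ∀ ε : ℕ → ℕ → ℝ,
      (∀ j k, ε j k = 1 ∨ ε j k = -1) →
      eLpNorm (Jneg2 s (sigmaN ϕ N ε)) (ENNReal.ofReal r) volume ≤
        ENNReal.ofReal (C * (N : ℝ) ^ s) := by
  have hcs : HasCompactSupport ϕ := by
    refine HasCompactSupport.intro (isCompact_Icc (a := (-(1 / 10) : ℝ)) (b := 1 / 10)) fun x hx => ?_
    by_contra h
    exact hx (abs_le.1 (hϕ_supp x h))
  obtain ⟨M, hM⟩ := hϕ_smooth.continuous.bounded_above_of_compact_support hcs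
  obtain ⟨L, hL⟩ := ContDiff.lipschitzWith_of_hasCompactSupport hcs hϕ_smooth (by simp)
  have hM' : ∀ x, |ϕ x| ≤ M := fun x => by rw [← Real.norm_eq_abs]; exact hM x
  have hL' : ∀ x y, |ϕ x - ϕ y| ≤ (L : ℝ) * |x - y| := fun x y => by
    have := hL.dist_le_mul x y
    rwa [Real.dist_eq, Real.dist_eq] at this
  have hM0 : 0 ≤ M := (abs_nonneg _).trans (hM' 0)
  have hL0 : (0 : ℝ) ≤ L := L.2
  refine ⟨(cBern (s / 2))⁻¹ * (2 * (M * M + 4 * L * M) * kM (s / 2)) * ((1 + 2 * kG) * 4), ?_⟩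
  intro N hN ε hε
  have hc : Continuous (sigmaN ϕ N ε) := by
    have := hϕ_smooth.continuous
    unfold sigmaN
    fun_prop
  have hsupp := sigmaN_supp ϕ hϕ_supp N hN ε
  have hi : Integrable (sigmaN ϕ N ε) := by
    refine hc.integrable_of_hasCompactSupport
      (HasCompactSupport.intro (K := boxB) (isCompact_Icc.prod isCompact_Icc) hsupp)
  refine J_Lr s r hs0 hs1 hr _ hc hi (M * M + 4 * L * M) N (by exact_mod_cast hN) ?_ ?_ hsupp
  · intro x
    have := sigmaN_bound ϕ hϕ_supp M hM' N ε hε x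
    have h2 : 0 ≤ 4 * L * M := by positivity
    linarith
  · intro x y
    refine (sigmaN_lip ϕ hϕ_supp M L hM' hL0 hL' N ε hε x y).trans ?_
    gcongr
    nlinarith

end
end

section
/- Let φ be a Schwartz function on ℝ, not identically zero, whose Fourier transform φ̂ is supported in [−1/100, 1/100]. For an integer N ≥ 1 and t ∈ [0,1] define f_{N,t}(x) = N^{−1} φ(x/N) Σ_{j=1}^N a_j(t) e^{2πi j x/N}, where a_j are the Rademacher functions. Then for every 0 < p < ∞ there exist constants c, C > 0 depending only on p and φ such that for all N ≥ 1: c·N^{1−p/2} ≤ ∫₀¹ ∫_ℝ |f_{N,t}(x)|^p dx dt ≤ C·N^{1−p/2}. -/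
open MeasureTheory

noncomputable section

/-- The Rademacher functions `a_j(t) = sign(sin(2^j π t))`. -/
def rademacher (j : ℕ) (t : ℝ) : ℝ := Real.sign (Real.sin (2 ^ j * Real.pi * t))

/-- The one-dimensional Fourier transform `f̂(ξ) = ∫ f(y) e^{-2πi yξ} dy`. -/
def ft1 (f : ℝ → ℂ) (ξ : ℝ) : ℂ :=
  ∫ y : ℝ, f y * Complex.exp (-(2 * Real.pi * Complex.I) * ((y * ξ : ℝ) : ℂ))

/-- `f_{N,t}(x) = N⁻¹ φ(x/N) Σ_{j=1}^N a_j(t) e^{2πi j x/N}`. -/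
def fNt (φ : SchwartzMap ℝ ℂ) (N : ℕ) (t : ℝ) (x : ℝ) : ℂ :=
  ((N : ℝ) : ℂ)⁻¹ * φ (x / N) * ∑ j ∈ Finset.Icc 1 N,
    (rademacher j t : ℂ) * Complex.exp ((2 * Real.pi * Complex.I) * (((j : ℝ) * x / N : ℝ) : ℂ))

lemma rad_meas (j : ℕ) : Measurable (rademacher j) := by
  have hs : Measurable Real.sign := by
    unfold Real.sign
    exact Measurable.ite measurableSet_Iio measurable_const
      (Measurable.ite measurableSet_Ioi measurable_const measurable_const)
  unfold rademacher
  exact hs.comp (by fun_prop)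

lemma rad_abs (j : ℕ) (t : ℝ) : |rademacher j t| ≤ 1 := by
  unfold rademacher Real.sign
  split_ifs <;> simp

lemma rad_integrable (F : (ℕ → ℝ) → ℝ) (hF : Continuous F) (a b : ℝ) :
    IntervalIntegrable (fun t => F (fun j => rademacher j t)) volume a b := by
  have hm : Measurable (fun t => F (fun j => rademacher j t)) :=
    hF.measurable.comp (measurable_pi_lambda _ rad_meas)
  have hc : IsCompact (Set.univ.pi (fun _ : ℕ => Set.Icc (-1 : ℝ) 1)) :=
    isCompact_univ_pi (fun _ => isCompact_Icc)
  obtain ⟨C, hC⟩ := hc.exists_bound_of_continuousOn hF.continuousOn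
  rw [intervalIntegrable_iff]
  have : IsFiniteMeasure (volume.restrict (Set.uIoc a b)) :=
    ⟨by rw [Measure.restrict_apply_univ, Set.uIoc]; exact measure_Ioc_lt_top⟩
  refine Integrable.of_bound hm.aestronglyMeasurable C (Filter.Eventually.of_forall fun t => ?_)
  apply hC
  intro j _
  exact abs_le.mp (rad_abs j t)

lemma rad_shift (j : ℕ) (t : ℝ) : rademacher (j + 1) t = rademacher j (2 * t) := by
  unfold rademacher
  congr 2
  ring

lemma rad_periodic (j : ℕ) : Function.Periodic (rademacher (j + 1)) 1 := by
  intro t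
  unfold rademacher
  have : (2 : ℝ) ^ (j + 1) * Real.pi * (t + 1) =
      2 ^ (j + 1) * Real.pi * t + ((2 ^ j : ℕ) : ℝ) * (2 * Real.pi) := by
    push_cast; ring
  rw [this, Real.sin_add_nat_mul_two_pi]

lemma rad_one_left {t : ℝ} (h0 : 0 < t) (h1 : t < 1 / 2) : rademacher 1 t = 1 := by
  unfold rademacher
  apply Real.sign_of_pos
  apply Real.sin_pos_of_pos_of_lt_pi
  · have := Real.pi_pos; positivity
  · nlinarith [Real.pi_pos]

lemma rad_one_right {t : ℝ} (h0 : 1 / 2 < t) (h1 : t < 1) : rademacher 1 t = -1 := by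
  unfold rademacher
  apply Real.sign_of_neg
  have : (2 : ℝ) ^ 1 * Real.pi * t = (2 * Real.pi * t - Real.pi) + Real.pi := by ring
  rw [this, Real.sin_add_pi, neg_lt_zero]
  apply Real.sin_pos_of_pos_of_lt_pi
  · nlinarith [Real.pi_pos]
  · nlinarith [Real.pi_pos]

lemma rad_prod (N : ℕ) : ∀ (h : ℕ → ℝ → ℝ), (∀ j, Continuous (h j)) →
    ∫ t in (0 : ℝ)..1, ∏ j ∈ Finset.range N, h j (rademacher (j + 1) t) =
      ∏ j ∈ Finset.range N, ((h j 1 + h j (-1)) / 2) := by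
  induction N with
  | zero => intro h _; simp
  | succ N ih =>
    intro h hc
    set G : ℝ → ℝ := fun s => ∏ j ∈ Finset.range N, h (j + 1) (rademacher (j + 1) s) with hG
    have hGp : Function.Periodic G 1 := by
      intro s
      simp only [hG]
      refine Finset.prod_congr rfl fun j _ => ?_
      rw [rad_periodic j s]
    have key : ∀ t, ∏ j ∈ Finset.range (N + 1), h j (rademacher (j + 1) t) =
        h 0 (rademacher 1 t) * G (2 * t) := by
      intro t
      rw [Finset.prod_range_succ', mul_comm]
      simp only [hG, rad_shift (_ + 1) t, zero_add]
    have hIble : ∀ a b, IntervalIntegrable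
        (fun t => ∏ j ∈ Finset.range (N + 1), h j (rademacher (j + 1) t)) volume a b := by
      intro a b
      exact rad_integrable (fun z => ∏ j ∈ Finset.range (N + 1), h j (z (j + 1)))
        (continuous_finsetProd _ fun j _ => (hc j).comp (continuous_apply _)) a b
    have ihG : ∫ s in (0 : ℝ)..1, G s =
        ∏ j ∈ Finset.range N, ((h (j + 1) 1 + h (j + 1) (-1)) / 2) :=
      ih (fun j => h (j + 1)) (fun j => hc _)
    have hG2 : ∫ s in (1 : ℝ)..2, G s = ∫ s in (0 : ℝ)..1, G s := by
      have := hGp.intervalIntegral_add_eq 1 0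
      norm_num at this
      exact this
    rw [← intervalIntegral.integral_add_adjacent_intervals (hIble 0 (1 / 2)) (hIble (1 / 2) 1)]
    have e1 : ∫ t in (0 : ℝ)..(1 / 2), ∏ j ∈ Finset.range (N + 1), h j (rademacher (j + 1) t) =
        ∫ t in (0 : ℝ)..(1 / 2), h 0 1 * G (2 * t) := by
      apply intervalIntegral.integral_congr_uIoo
      intro t ht
      rw [Set.uIoo_of_le (by norm_num)] at ht
      simp only [key, rad_one_left ht.1 ht.2]
    have e2 : ∫ t in (1 / 2 : ℝ)..1, ∏ j ∈ Finset.range (N + 1), h j (rademacher (j + 1) t) =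
        ∫ t in (1 / 2 : ℝ)..1, h 0 (-1) * G (2 * t) := by
      apply intervalIntegral.integral_congr_uIoo
      intro t ht
      rw [Set.uIoo_of_le (by norm_num)] at ht
      simp only [key, rad_one_right ht.1 ht.2]
    rw [e1, e2, intervalIntegral.integral_const_mul, intervalIntegral.integral_const_mul,
      intervalIntegral.integral_comp_mul_left _ two_ne_zero,
      intervalIntegral.integral_comp_mul_left _ two_ne_zero]
    rw [show (2 : ℝ) * 0 = 0 by norm_num, show (2 : ℝ) * (1 / 2) = 1 by norm_num,
      show (2 : ℝ) * 1 = 2 by norm_num, hG2, ihG, Finset.prod_range_succ']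
    generalize ∏ j ∈ Finset.range N, ((h (j + 1) 1 + h (j + 1) (-1)) / 2) = P
    simp only [smul_eq_mul]
    ring

lemma rad_exp (N : ℕ) (u : ℕ → ℝ) :
    ∫ t in (0 : ℝ)..1, Real.exp (∑ j ∈ Finset.range N, rademacher (j + 1) t * u j) ≤
      Real.exp ((∑ j ∈ Finset.range N, u j ^ 2) / 2) := by
  simp only [Real.exp_sum]
  rw [rad_prod N (fun j a => Real.exp (a * u j)) (fun j => by fun_prop), Finset.sum_div,
    Real.exp_sum]
  refine Finset.prod_le_prod (fun j _ => by positivity) fun j _ => ?_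
  have := Real.cosh_le_exp_half_sq (u j)
  rw [Real.cosh_eq] at this
  simpa using this

lemma rad_orth (N i j : ℕ) (hi : i < N) (hj : j < N) :
    ∫ t in (0 : ℝ)..1, rademacher (i + 1) t * rademacher (j + 1) t = if i = j then 1 else 0 := by
  have := rad_prod N (fun k a => (if k = i then a else 1) * (if k = j then a else 1))
    (fun k => by
      by_cases h1 : k = i <;> by_cases h2 : k = j <;> simp only [h1, h2, if_true, if_false] <;>
        (try split_ifs) <;> fun_prop)
  simp only [Finset.prod_mul_distrib, Finset.prod_ite_eq', Finset.mem_range, hi, hj, if_true]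
    at this
  rw [this]
  split_ifs with h
  · subst h
    apply Finset.prod_eq_one
    intro k _
    split_ifs <;> norm_num
  · apply Finset.prod_eq_zero (Finset.mem_range.mpr hi)
    simp [h]

lemma rad_sq (N : ℕ) (u : ℕ → ℝ) :
    ∫ t in (0 : ℝ)..1, (∑ j ∈ Finset.range N, rademacher (j + 1) t * u j) ^ 2 =
      ∑ j ∈ Finset.range N, u j ^ 2 := by
  have : ∀ t, (∑ j ∈ Finset.range N, rademacher (j + 1) t * u j) ^ 2 =
      ∑ i ∈ Finset.range N, ∑ j ∈ Finset.range N,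
        (u i * u j) * (rademacher (i + 1) t * rademacher (j + 1) t) := by
    intro t
    rw [sq, Finset.sum_mul_sum]
    refine Finset.sum_congr rfl fun i _ => Finset.sum_congr rfl fun j _ => by ring
  simp only [this]
  rw [intervalIntegral.integral_finsetSum]
  · refine Finset.sum_congr rfl fun i hi => ?_
    rw [intervalIntegral.integral_finsetSum]
    · rw [Finset.sum_eq_single i]
      · rw [intervalIntegral.integral_const_mul,
          rad_orth N i i (Finset.mem_range.mp hi) (Finset.mem_range.mp hi)]
        simp [sq]
      · intro j hj hji
        rw [intervalIntegral.integral_const_mul,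
          rad_orth N i j (Finset.mem_range.mp hi) (Finset.mem_range.mp hj)]
        simp [Ne.symm hji]
      · intro h; exact absurd hi h
    · intro j _
      exact rad_integrable (fun z => (u i * u j) * (z (i + 1) * z (j + 1))) (by fun_prop) _ _
  · intro i _
    exact rad_integrable (fun z => ∑ j ∈ Finset.range N, (u i * u j) * (z (i + 1) * z (j + 1)))
      (by fun_prop) _ _

lemma rpow_le_exp (p : ℝ) (hp : 0 < p) :
    ∃ C : ℝ, 0 < C ∧ ∀ z : ℝ, 0 ≤ z → z ^ p ≤ C * Real.exp (z / 2) := by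
  obtain ⟨n, hn⟩ := exists_nat_ge p
  refine ⟨1 + 2 ^ n * n.factorial, by positivity, fun z hz => ?_⟩
  have h1 : 1 ≤ Real.exp (z / 2) := Real.one_le_exp (by positivity)
  have h2 := Real.pow_div_factorial_le_exp (z / 2) (by positivity) n
  rw [div_le_iff₀ (by positivity), div_pow, div_le_iff₀ (by positivity)] at h2
  have h3 : z ^ p ≤ 1 + z ^ n := by
    rcases le_total z 1 with h | h
    · have := Real.rpow_le_one hz h hp.le
      have : 0 ≤ z ^ n := by positivity
      linarith
    · have := Real.rpow_le_rpow_of_exponent_le h hn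
      rw [Real.rpow_natCast] at this
      linarith
  nlinarith

lemma exp_four (w : ℂ) : Real.exp (‖w‖ / 2) ≤
    Real.exp w.re + Real.exp (-w.re) + (Real.exp w.im + Real.exp (-w.im)) := by
  have h := Complex.norm_le_abs_re_add_abs_im w
  have a1 : Real.exp |w.re| ≤ Real.exp w.re + Real.exp (-w.re) := by
    rcases abs_cases w.re with h | h <;> rw [h.1] <;>
      linarith [Real.exp_pos w.re, Real.exp_pos (-w.re)]
  have a2 : Real.exp |w.im| ≤ Real.exp w.im + Real.exp (-w.im) := by
    rcases abs_cases w.im with h | h <;> rw [h.1] <;>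
      linarith [Real.exp_pos w.im, Real.exp_pos (-w.im)]
  rcases le_total |w.re| |w.im| with h' | h'
  · have : Real.exp (‖w‖ / 2) ≤ Real.exp |w.im| := Real.exp_le_exp.mpr (by linarith)
    linarith [Real.exp_pos w.re, Real.exp_pos (-w.re)]
  · have : Real.exp (‖w‖ / 2) ≤ Real.exp |w.re| := Real.exp_le_exp.mpr (by linarith)
    linarith [Real.exp_pos w.im, Real.exp_pos (-w.im)]

/-- The Rademacher sum. -/
def rsum (N : ℕ) (w : ℕ → ℂ) (t : ℝ) : ℂ :=
  ∑ j ∈ Finset.range N, (rademacher (j + 1) t : ℂ) * w j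

lemma rsum_re (N : ℕ) (w : ℕ → ℂ) (t : ℝ) :
    (rsum N w t).re = ∑ j ∈ Finset.range N, rademacher (j + 1) t * (w j).re := by
  simp [rsum]

lemma rsum_im (N : ℕ) (w : ℕ → ℂ) (t : ℝ) :
    (rsum N w t).im = ∑ j ∈ Finset.range N, rademacher (j + 1) t * (w j).im := by
  simp [rsum]

lemma rsum_integrable (N : ℕ) (w : ℕ → ℂ) (g : ℂ → ℝ) (hg : Continuous g) (a b : ℝ) :
    IntervalIntegrable (fun t => g (rsum N w t)) volume a b :=
  rad_integrable (fun z => g (∑ j ∈ Finset.range N, (z (j + 1) : ℂ) * w j))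
    (hg.comp (by fun_prop)) a b

lemma khin_upper (p : ℝ) (hp : 0 < p) : ∃ C : ℝ, 0 < C ∧ ∀ (N : ℕ) (w : ℕ → ℂ),
    ∑ j ∈ Finset.range N, ‖w j‖ ^ 2 = 1 → ∫ t in (0 : ℝ)..1, ‖rsum N w t‖ ^ p ≤ C := by
  obtain ⟨C, hC, hz⟩ := rpow_le_exp p hp
  refine ⟨C * (4 * Real.exp (1 / 2)), by positivity, fun N w hw => ?_⟩
  have hsum : ∑ j ∈ Finset.range N, (w j).re ^ 2 + ∑ j ∈ Finset.range N, (w j).im ^ 2 = 1 := by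
    rw [← hw, ← Finset.sum_add_distrib]
    refine Finset.sum_congr rfl fun j _ => ?_
    rw [Complex.sq_norm, Complex.normSq_apply]; ring
  have n1 : 0 ≤ ∑ j ∈ Finset.range N, (w j).re ^ 2 := Finset.sum_nonneg fun _ _ => sq_nonneg _
  have n2 : 0 ≤ ∑ j ∈ Finset.range N, (w j).im ^ 2 := Finset.sum_nonneg fun _ _ => sq_nonneg _
  have b : ∀ u : ℕ → ℝ, ∑ j ∈ Finset.range N, u j ^ 2 ≤ 1 →
      ∫ t in (0 : ℝ)..1, Real.exp (∑ j ∈ Finset.range N, rademacher (j + 1) t * u j) ≤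
        Real.exp (1 / 2) := fun u hu =>
    (rad_exp N u).trans (Real.exp_le_exp.mpr (by linarith))
  have b1 := b (fun j => (w j).re) (by linarith)
  have b2 := b (fun j => -(w j).re) (by simp only [neg_sq]; linarith)
  have b3 := b (fun j => (w j).im) (by linarith)
  have b4 := b (fun j => -(w j).im) (by simp only [neg_sq]; linarith)
  simp only [mul_neg, Finset.sum_neg_distrib, ← rsum_re, ← rsum_im] at b1 b2 b3 b4
  have i1 := rsum_integrable N w (fun z => Real.exp z.re) (by fun_prop) 0 1
  have i2 := rsum_integrable N w (fun z => Real.exp (-z.re)) (by fun_prop) 0 1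
  have i3 := rsum_integrable N w (fun z => Real.exp z.im) (by fun_prop) 0 1
  have i4 := rsum_integrable N w (fun z => Real.exp (-z.im)) (by fun_prop) 0 1
  calc ∫ t in (0 : ℝ)..1, ‖rsum N w t‖ ^ p
      ≤ ∫ t in (0 : ℝ)..1, C * (Real.exp (rsum N w t).re + Real.exp (-(rsum N w t).re) +
          (Real.exp (rsum N w t).im + Real.exp (-(rsum N w t).im))) := by
        apply intervalIntegral.integral_mono_on zero_le_one
        · exact rsum_integrable N w (fun z => ‖z‖ ^ p)
            (continuous_norm.rpow_const fun _ => Or.inr hp.le) 0 1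
        · exact rsum_integrable N w (fun z => C * (Real.exp z.re + Real.exp (-z.re) +
            (Real.exp z.im + Real.exp (-z.im)))) (by fun_prop) 0 1
        · intro t _
          exact (hz _ (norm_nonneg _)).trans (mul_le_mul_of_nonneg_left (exp_four _) hC.le)
    _ ≤ _ := by
        rw [intervalIntegral.integral_const_mul,
          intervalIntegral.integral_add (i1.add i2) (i3.add i4),
          intervalIntegral.integral_add i1 i2, intervalIntegral.integral_add i3 i4]
        apply mul_le_mul_of_nonneg_left _ hC.le
        linarith

lemma khin_sq (N : ℕ) (w : ℕ → ℂ) :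
    ∫ t in (0 : ℝ)..1, ‖rsum N w t‖ ^ 2 = ∑ j ∈ Finset.range N, ‖w j‖ ^ 2 := by
  have e : ∀ z : ℂ, ‖z‖ ^ 2 = z.re ^ 2 + z.im ^ 2 := fun z => by
    rw [Complex.sq_norm, Complex.normSq_apply]; ring
  simp only [e]
  rw [intervalIntegral.integral_add
    (rsum_integrable N w (fun z => z.re ^ 2) (by fun_prop) 0 1)
    (rsum_integrable N w (fun z => z.im ^ 2) (by fun_prop) 0 1)]
  simp only [rsum_re, rsum_im]
  rw [rad_sq, rad_sq, Finset.sum_add_distrib]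

lemma khin_lower (p : ℝ) (hp : 0 < p) : ∃ c : ℝ, 0 < c ∧ ∀ (N : ℕ) (w : ℕ → ℂ),
    ∑ j ∈ Finset.range N, ‖w j‖ ^ 2 = 1 → c ≤ ∫ t in (0 : ℝ)..1, ‖rsum N w t‖ ^ p := by
  obtain ⟨K, hK, hK4⟩ := khin_upper 4 (by norm_num)
  set B : ℝ := 4 * K / (1 / 2 : ℝ) ^ p with hB
  have hBpos : 0 < B := by positivity
  -- pointwise: z² ≤ 1/4 + z⁴/(4K) + B z^p
  have hpt : ∀ z : ℝ, 0 ≤ z → z ^ 2 ≤ 1 / 4 + (1 / (4 * K)) * z ^ (4 : ℝ) + B * z ^ p := by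
    intro z hz
    have hz4 : z ^ (4 : ℝ) = z ^ 4 := by exact_mod_cast Real.rpow_natCast z 4
    rw [hz4]
    have q1 : 0 ≤ (1 / (4 * K)) * z ^ 4 := by positivity
    have q2 : 0 ≤ B * z ^ p := by positivity
    rcases le_total z (1 / 2) with h | h
    · nlinarith
    · rcases le_total (z ^ 2) (4 * K) with h' | h'
      · have : (1 / 2 : ℝ) ^ p ≤ z ^ p := Real.rpow_le_rpow (by norm_num) h hp.le
        have : 4 * K ≤ B * z ^ p := by
          rw [hB, div_mul_eq_mul_div, le_div_iff₀ (by positivity)]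
          exact mul_le_mul_of_nonneg_left this (by positivity)
        linarith
      · have : z ^ 2 ≤ (1 / (4 * K)) * z ^ 4 := by
          rw [div_mul_eq_mul_div, le_div_iff₀ (by positivity)]
          nlinarith [sq_nonneg z]
        linarith
  refine ⟨1 / (2 * B), by positivity, fun N w hw => ?_⟩
  have i4 := rsum_integrable N w (fun z => ‖z‖ ^ (4 : ℝ))
            (continuous_norm.rpow_const fun _ => Or.inr (by norm_num)) 0 1
  have ip := rsum_integrable N w (fun z => ‖z‖ ^ p)
            (continuous_norm.rpow_const fun _ => Or.inr hp.le) 0 1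
  have i0 : IntervalIntegrable (fun _ : ℝ => (1 / 4 : ℝ)) volume 0 1 := intervalIntegrable_const
  have main : ∫ t in (0 : ℝ)..1, ‖rsum N w t‖ ^ 2 ≤
      ∫ t in (0 : ℝ)..1, (1 / 4 + (1 / (4 * K)) * ‖rsum N w t‖ ^ (4 : ℝ) +
        B * ‖rsum N w t‖ ^ p) := by
    apply intervalIntegral.integral_mono_on zero_le_one
    · exact rsum_integrable N w (fun z => ‖z‖ ^ 2) (by fun_prop) 0 1
    · exact (i0.add (i4.const_mul _)).add (ip.const_mul _)
    · intro t _
      exact hpt _ (norm_nonneg _)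
  rw [khin_sq, hw, intervalIntegral.integral_add (i0.add (i4.const_mul _)) (ip.const_mul _),
    intervalIntegral.integral_add i0 (i4.const_mul _), intervalIntegral.integral_const_mul,
    intervalIntegral.integral_const_mul, intervalIntegral.integral_const] at main
  have h4 := hK4 N w hw
  have : 1 / (4 * K) * ∫ t in (0 : ℝ)..1, ‖rsum N w t‖ ^ (4 : ℝ) ≤ 1 / 4 := by
    rw [div_mul_eq_mul_div, div_le_iff₀ (by positivity)]
    linarith
  rw [div_le_iff₀ (by positivity)]
  norm_num at main this ⊢
  linarith

lemma khin (p : ℝ) (hp : 0 < p) : ∃ c C : ℝ, 0 < c ∧ 0 < C ∧ ∀ (N : ℕ) (w : ℕ → ℂ), 1 ≤ N →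
    (∀ j, ‖w j‖ = 1) → c * (N : ℝ) ^ (p / 2) ≤ ∫ t in (0 : ℝ)..1, ‖rsum N w t‖ ^ p ∧
      ∫ t in (0 : ℝ)..1, ‖rsum N w t‖ ^ p ≤ C * (N : ℝ) ^ (p / 2) := by
  obtain ⟨c, hc, hcl⟩ := khin_lower p hp
  obtain ⟨C, hC, hCu⟩ := khin_upper p hp
  refine ⟨c, C, hc, hC, fun N w hN hw => ?_⟩
  have hNpos : (0 : ℝ) < N := by exact_mod_cast hN
  have hs : 0 < Real.sqrt N := Real.sqrt_pos.mpr hNpos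
  set v : ℕ → ℂ := fun j => ((Real.sqrt N)⁻¹ : ℝ) * w j with hv
  have hv1 : ∑ j ∈ Finset.range N, ‖v j‖ ^ 2 = 1 := by
    simp only [hv, norm_mul, hw, mul_one, Complex.norm_real, Real.norm_eq_abs, sq_abs, inv_pow,
      Real.sq_sqrt hNpos.le, Finset.sum_const, Finset.card_range, nsmul_eq_mul]
    field_simp
  have hr : ∀ t, ‖rsum N w t‖ ^ p = (N : ℝ) ^ (p / 2) * ‖rsum N v t‖ ^ p := by
    intro t
    have e : rsum N w t = (Real.sqrt N : ℂ) * rsum N v t := by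
      simp only [rsum, hv, Finset.mul_sum]
      refine Finset.sum_congr rfl fun j _ => ?_
      have : (Real.sqrt N : ℂ) ≠ 0 := by exact_mod_cast hs.ne'
      push_cast
      field_simp
    rw [e, norm_mul, Complex.norm_real, Real.norm_eq_abs, abs_of_pos hs,
      Real.mul_rpow hs.le (norm_nonneg _), Real.sqrt_eq_rpow, ← Real.rpow_mul hNpos.le]
    congr 2
    ring
  simp only [hr]
  rw [intervalIntegral.integral_const_mul]
  have hp' : (0 : ℝ) ≤ (N : ℝ) ^ (p / 2) := by positivity
  constructor
  · rw [mul_comm]; exact mul_le_mul_of_nonneg_left (hcl N v hv1) hp'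
  · rw [mul_comm C]; exact mul_le_mul_of_nonneg_left (hCu N v hv1) hp'

/-- unimodular coefficients -/
def wc (N : ℕ) (x : ℝ) (j : ℕ) : ℂ :=
  Complex.exp ((2 * Real.pi * Complex.I) * ((((j + 1 : ℕ) : ℝ) * x / N : ℝ) : ℂ))

lemma wc_norm (N : ℕ) (x : ℝ) (j : ℕ) : ‖wc N x j‖ = 1 := by
  unfold wc
  have : (2 * Real.pi * Complex.I) * ((((j + 1 : ℕ) : ℝ) * x / N : ℝ) : ℂ) =
      ((2 * Real.pi * (((j + 1 : ℕ) : ℝ) * x / N) : ℝ) : ℂ) * Complex.I := by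
    push_cast; ring
  rw [this, Complex.norm_exp_ofReal_mul_I]

lemma fNt_eq (φ : SchwartzMap ℝ ℂ) (N : ℕ) (t x : ℝ) :
    fNt φ N t x = ((N : ℝ) : ℂ)⁻¹ * φ (x / N) * rsum N (wc N x) t := by
  unfold fNt rsum wc
  rw [← Finset.Ico_add_one_right_eq_Icc, Finset.sum_Ico_eq_sum_range]
  simp only [Nat.add_sub_cancel, add_comm 1]

/-- **Khinchine-type estimate for `f_N`.** If `φ` is a nonzero Schwartz function with
`φ̂` supported in `[-1/100, 1/100]`, then for `0 < p < ∞`,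
`∫₀¹∫_ℝ |f_{N,t}(x)|^p dx dt ≈ N^{1-p/2}`, with constants depending only on `p` and `φ`. -/
theorem fN_Lp_estimate (φ : SchwartzMap ℝ ℂ) (hφ_ne : φ ≠ 0)
    (hφ_supp : ∀ ξ : ℝ, ft1 (⇑φ) ξ ≠ 0 → |ξ| ≤ 1 / 100)
    (p : ℝ) (hp : 0 < p) :
    ∃ c C : ℝ, 0 < c ∧ 0 < C ∧ ∀ N : ℕ, 1 ≤ N →
      c * (N : ℝ) ^ (1 - p / 2) ≤
        (∫ t in Set.Icc (0 : ℝ) 1, ∫ x : ℝ, ‖fNt φ N t x‖ ^ p) ∧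
      (∫ t in Set.Icc (0 : ℝ) 1, ∫ x : ℝ, ‖fNt φ N t x‖ ^ p) ≤
        C * (N : ℝ) ^ (1 - p / 2) := by
  obtain ⟨c, C, hc, hC, hk⟩ := khin p hp
  have hφi : Integrable (fun x => ‖φ x‖ ^ p) := by
    have := (φ.memLp (ENNReal.ofReal p) volume).integrable_norm_rpow
      (by simpa using hp) ENNReal.ofReal_ne_top
    simpa [ENNReal.toReal_ofReal hp.le] using this
  have hφc : Continuous (fun x => ‖φ x‖ ^ p) :=
    φ.continuous.norm.rpow_const fun _ => Or.inr hp.le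
  set A : ℝ := ∫ x, ‖φ x‖ ^ p with hA
  have hApos : 0 < A := by
    obtain ⟨x, hx⟩ : ∃ x, φ x ≠ 0 := by
      by_contra! h
      exact hφ_ne (SchwartzMap.ext h)
    exact integral_pos_of_integrable_nonneg_nonzero (x := x) hφc hφi
      (fun x => by positivity) (by have := norm_pos_iff.mpr hx; positivity)
  refine ⟨c * A, C * A, by positivity, by positivity, fun N hN => ?_⟩
  have hNpos : (0 : ℝ) < N := by exact_mod_cast hN
  have hnorm : ∀ t x, ‖fNt φ N t x‖ ^ p =
      (N : ℝ) ^ (-p) * ‖φ (x / N)‖ ^ p * ‖rsum N (wc N x) t‖ ^ p := by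
    intro t x
    rw [fNt_eq, norm_mul, norm_mul, Real.mul_rpow (by positivity) (by positivity),
      Real.mul_rpow (by positivity) (by positivity), norm_inv, Complex.norm_real,
      Real.norm_eq_abs, abs_of_pos hNpos, Real.inv_rpow hNpos.le, Real.rpow_neg hNpos.le]
  have hφN : Integrable (fun x : ℝ => ‖φ (x / N)‖ ^ p) := hφi.comp_div hNpos.ne'
  have hφNi : ∫ x : ℝ, ‖φ (x / N)‖ ^ p = N * A := by
    rw [Measure.integral_comp_div (fun x => ‖φ x‖ ^ p) (N : ℝ), abs_of_pos hNpos, smul_eq_mul]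
  have hrs : ∀ t x, ‖rsum N (wc N x) t‖ ≤ N := by
    intro t x
    unfold rsum
    refine (norm_sum_le _ _).trans ?_
    have : ∑ j ∈ Finset.range N, ‖(rademacher (j + 1) t : ℂ) * wc N x j‖ ≤
        ∑ j ∈ Finset.range N, 1 := by
      refine Finset.sum_le_sum fun j _ => ?_
      rw [norm_mul, wc_norm, mul_one, Complex.norm_real]
      exact rad_abs _ _
    simpa using this
  have hmeas : Measurable (Function.uncurry fun t x => ‖fNt φ N t x‖ ^ p) := by
    have hr : ∀ j, Measurable fun q : ℝ × ℝ => rademacher j q.1 :=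
      fun j => (rad_meas j).comp measurable_fst
    have hphi : Measurable (fun q : ℝ × ℝ => φ (q.2 / N)) :=
      φ.continuous.measurable.comp (by fun_prop)
    have : Measurable (fun q : ℝ × ℝ => fNt φ N q.1 q.2) := by
      unfold fNt
      refine (measurable_const.mul hphi).mul (Finset.measurable_sum _ fun j _ => ?_)
      exact (Complex.measurable_ofReal.comp (hr j)).mul (by fun_prop)
    exact this.norm.pow_const p
  have hIble : Integrable (Function.uncurry fun t x => ‖fNt φ N t x‖ ^ p)
      ((volume.restrict (Set.Icc (0 : ℝ) 1)).prod volume) := by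
    have hg : Integrable (fun q : ℝ × ℝ =>
        (1 : ℝ) * (((N : ℝ) ^ (-p) * (N : ℝ) ^ p) * ‖φ (q.2 / N)‖ ^ p))
        ((volume.restrict (Set.Icc (0 : ℝ) 1)).prod volume) :=
      Integrable.mul_prod (f := fun _ : ℝ => (1 : ℝ)) (integrable_const 1) (hφN.const_mul _)
    refine hg.mono' hmeas.aestronglyMeasurable (Filter.Eventually.of_forall ?_)
    rintro ⟨t, x⟩
    simp only [Function.uncurry_apply_pair]
    rw [Real.norm_of_nonneg (by positivity), hnorm]
    have : ‖rsum N (wc N x) t‖ ^ p ≤ (N : ℝ) ^ p :=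
      Real.rpow_le_rpow (norm_nonneg _) (hrs t x) hp.le
    calc _ ≤ (N : ℝ) ^ (-p) * ‖φ (x / N)‖ ^ p * (N : ℝ) ^ p :=
          mul_le_mul_of_nonneg_left this (by positivity)
      _ = _ := by ring
  have hIble2 := hIble.integral_prod_right
  rw [integral_integral_swap hIble]
  simp only [Function.uncurry_apply_pair] at hIble2
  have hin : ∀ x, ∫ t in Set.Icc (0 : ℝ) 1, ‖fNt φ N t x‖ ^ p =
      (N : ℝ) ^ (-p) * ‖φ (x / N)‖ ^ p * ∫ t in (0 : ℝ)..1, ‖rsum N (wc N x) t‖ ^ p := by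
    intro x
    simp only [hnorm]
    rw [integral_const_mul, integral_Icc_eq_integral_Ioc,
      intervalIntegral.integral_of_le zero_le_one]
  have hconst : ∀ d : ℝ, ∫ x : ℝ, ((N : ℝ) ^ (-p) * (d * (N : ℝ) ^ (p / 2))) * ‖φ (x / N)‖ ^ p
      = d * A * (N : ℝ) ^ (1 - p / 2) := by
    intro d
    rw [integral_const_mul, hφNi]
    have : (N : ℝ) ^ (1 - p / 2) = (N : ℝ) ^ (-p) * (N : ℝ) ^ (p / 2) * N := by
      rw [← Real.rpow_add hNpos]
      nth_rewrite 3 [← Real.rpow_one (N : ℝ)]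
      rw [← Real.rpow_add hNpos]
      congr 1; ring
    rw [this]; ring
  constructor
  · rw [← hconst c]
    refine integral_mono (hφN.const_mul _) hIble2 fun x => ?_
    simp only [hin]
    have := mul_le_mul_of_nonneg_left (hk N (wc N x) hN (wc_norm N x)).1
      (show 0 ≤ (N : ℝ) ^ (-p) * ‖φ (x / N)‖ ^ p by positivity)
    refine le_trans (le_of_eq ?_) this
    ring
  · rw [← hconst C]
    refine integral_mono hIble2 (hφN.const_mul _) fun x => ?_
    simp only [hin]
    have := mul_le_mul_of_nonneg_left (hk N (wc N x) hN (wc_norm N x)).2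
      (show 0 ≤ (N : ℝ) ^ (-p) * ‖φ (x / N)‖ ^ p by positivity)
    refine le_trans this (le_of_eq ?_)
    ring

end
end

section
/- Let φ be a Schwartz function on ℝ whose Fourier transform φ̂ is supported in [−1/100, 1/100]. For an integer N ≥ 1 define g_N(x) = N^{−1} φ(x/N) Σ_{j=−N}^N e^{2πi j x/N}. Then for every 1 < p < ∞ there exists a constant C depending only on p and φ (not on N) such that ‖g_N‖_{L^p(ℝ)} ≤ C for all N ≥ 1. -/
open MeasureTheory

noncomputable section

/-- `g_N(x) = N⁻¹ φ(x/N) Σ_{j=-N}^N e^{2πi j x/N}`. -/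
def gN (φ : SchwartzMap ℝ ℂ) (N : ℕ) (x : ℝ) : ℂ :=
  ((N : ℝ) : ℂ)⁻¹ * φ (x / N) * ∑ j ∈ Finset.Icc (-(N : ℤ)) (N : ℤ),
    Complex.exp ((2 * Real.pi * Complex.I) * (((j : ℝ) * x / N : ℝ) : ℂ))

theorem aux_telescope (z : ℂ) (hz : z ≠ 0) (n : ℕ) :
    (z - 1) * ∑ j ∈ Finset.Icc (-(n : ℤ)) (n : ℤ), z ^ j = z ^ ((n : ℤ) + 1) - z ^ (-(n : ℤ)) := by
  induction n with
  | zero => simp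
  | succ n ih =>
    have h : Finset.Icc (-((n + 1 : ℕ) : ℤ)) ((n + 1 : ℕ) : ℤ)
        = insert ((n : ℤ) + 1) (insert (-((n : ℤ) + 1)) (Finset.Icc (-(n : ℤ)) (n : ℤ))) := by
      ext a; simp; omega
    rw [h, Finset.sum_insert (by simp; omega), Finset.sum_insert (by simp), mul_add, mul_add, ih]
    have h1 : z ^ (((n + 1 : ℕ) : ℤ) + 1) = z ^ ((n : ℤ) + 1) * z := by
      push_cast
      rw [zpow_add_one₀ hz ((n : ℤ) + 1)]
    have h2 : z ^ (-(n : ℤ)) = z ^ (-((n : ℤ) + 1)) * z := by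
      rw [← zpow_add_one₀ hz]; congr 1; ring
    have h3 : z ^ (-((n + 1 : ℕ) : ℤ)) = z ^ (-((n : ℤ) + 1)) := by push_cast; rfl
    rw [h1, h2, h3]; ring

theorem aux_sum_bound (N : ℕ) (hN : 1 ≤ N) (x : ℝ) (k : ℤ) (hk : |x / N - k| ≤ 1 / 2) :
    ‖∑ j ∈ Finset.Icc (-(N : ℤ)) (N : ℤ),
      Complex.exp ((2 * Real.pi * Complex.I) * (((j : ℝ) * x / N : ℝ) : ℂ))‖
      * (1 + |x - k * N|) ≤ 4 * N := by
  have hN0 : (1 : ℝ) ≤ N := by exact_mod_cast hN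
  set θ : ℝ := x / N with hθ
  set z : ℂ := Complex.exp (Complex.I * ((2 * Real.pi * θ : ℝ) : ℂ)) with hzdef
  have hz : z ≠ 0 := Complex.exp_ne_zero _
  have hzn : ‖z‖ = 1 := by rw [hzdef, mul_comm, Complex.norm_exp_ofReal_mul_I]
  have hsum : ∑ j ∈ Finset.Icc (-(N : ℤ)) (N : ℤ),
      Complex.exp ((2 * Real.pi * Complex.I) * (((j : ℝ) * x / N : ℝ) : ℂ))
      = ∑ j ∈ Finset.Icc (-(N : ℤ)) (N : ℤ), z ^ j := by
    refine Finset.sum_congr rfl fun j _ => ?_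
    rw [hzdef, ← Complex.exp_int_mul, hθ]
    congr 1
    push_cast
    ring
  rw [hsum]
  set S := ∑ j ∈ Finset.Icc (-(N : ℤ)) (N : ℤ), z ^ j with hS
  have hS1 : ‖S‖ ≤ 3 * N := by
    refine (norm_sum_le _ _).trans ?_
    simp only [norm_zpow, hzn, one_zpow]
    simp only [Finset.sum_const, Int.card_Icc, nsmul_eq_mul, mul_one]
    have : (((N : ℤ) + 1 - -(N : ℤ)).toNat) = 2 * N + 1 := by omega
    rw [this]; push_cast; linarith
  have hS2 : ‖z - 1‖ * ‖S‖ ≤ 2 := by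
    rw [← norm_mul, aux_telescope z hz N]
    refine (norm_sub_le _ _).trans ?_
    simp only [norm_zpow, hzn, one_zpow]
    norm_num
  have hz1 : 4 * |θ - k| ≤ ‖z - 1‖ := by
    have e : z = Complex.exp (Complex.I * ((2 * Real.pi * (θ - k) : ℝ) : ℂ)) := by
      rw [hzdef, Complex.exp_eq_exp_iff_exists_int]
      refine ⟨k, ?_⟩
      push_cast; ring
    rw [e, Complex.norm_exp_I_mul_ofReal_sub_one, Real.norm_eq_abs, abs_mul, abs_two]
    have hpi := Real.pi_pos
    have h2 : 2 * Real.pi * (θ - k) / 2 = Real.pi * (θ - k) := by ring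
    rw [h2]
    have h3 : |Real.pi * (θ - k)| = Real.pi * |θ - k| := by rw [abs_mul, abs_of_pos hpi]
    have h4 := Real.mul_abs_le_abs_sin (x := Real.pi * (θ - k)) (by rw [h3]; nlinarith)
    rw [h3] at h4
    have h5 : 2 / Real.pi * (Real.pi * |θ - k|) = 2 * |θ - k| := by field_simp
    linarith
  have hx : |x - k * N| = N * |θ - k| := by
    have : x - k * N = N * (θ - k) := by rw [hθ]; field_simp
    rw [this, abs_mul, abs_of_pos (by linarith)]
  rw [hx]
  have h6 : 4 * |θ - k| * ‖S‖ ≤ 2 :=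
    (mul_le_mul_of_nonneg_right hz1 (norm_nonneg _)).trans hS2
  nlinarith

theorem aux_pointwise (φ : SchwartzMap ℝ ℂ) : ∃ A : ℝ, 0 ≤ A ∧ ∀ N : ℕ, 1 ≤ N → ∀ (x : ℝ) (k : ℤ),
    |x / N - k| ≤ 1 / 2 → ‖gN φ N x‖ ≤ A / (1 + (k : ℝ) ^ 2) * (1 + |x - k * N|)⁻¹ := by
  obtain ⟨C0, hC0, h0⟩ := φ.decay 0 0
  obtain ⟨C2, hC2, h2⟩ := φ.decay 2 0
  refine ⟨8 * (C0 + C2), by positivity, fun N hN x k hk => ?_⟩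
  have hN0 : (1 : ℝ) ≤ N := by exact_mod_cast hN
  have hS := aux_sum_bound N hN x k hk
  have h0' := h0 (x / N)
  have h2' := h2 (x / N)
  simp only [norm_iteratedFDeriv_zero, pow_zero, one_mul, Real.norm_eq_abs, sq_abs] at h0' h2'
  have hφ : ‖φ (x / N)‖ * (1 + (k : ℝ) ^ 2) ≤ 2 * (C0 + C2) := by
    have hk2 : (x / N - k) ^ 2 ≤ 1 / 4 := by
      rw [← sq_abs]; nlinarith [abs_nonneg (x / N - k)]
    have : 1 + (k : ℝ) ^ 2 ≤ 2 * (1 + (x / N) ^ 2) := by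
      nlinarith [sq_nonneg (2 * (x / N) - k)]
    have := mul_le_mul_of_nonneg_left this (norm_nonneg (φ (x / N)))
    linarith
  rw [← div_eq_mul_inv, div_div, le_div_iff₀ (by positivity)]
  unfold gN
  rw [norm_mul, norm_mul, norm_inv, Complex.norm_real, Real.norm_eq_abs, abs_of_pos (by linarith)]
  set S := ‖∑ j ∈ Finset.Icc (-(N : ℤ)) (N : ℤ),
      Complex.exp ((2 * Real.pi * Complex.I) * (((j : ℝ) * x / N : ℝ) : ℂ))‖
  have hm := mul_le_mul hφ hS (by positivity) (by positivity)
  calc (N : ℝ)⁻¹ * ‖φ (x / N)‖ * S * ((1 + (k : ℝ) ^ 2) * (1 + |x - k * N|))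
      = (N : ℝ)⁻¹ * (‖φ (x / N)‖ * (1 + (k : ℝ) ^ 2) * (S * (1 + |x - k * N|))) := by ring
    _ ≤ (N : ℝ)⁻¹ * (2 * (C0 + C2) * (4 * N)) := by gcongr
    _ = 8 * (C0 + C2) := by field_simp; ring

theorem aux_summable (A : ℝ) (hA : 0 ≤ A) (p : ℝ) (hp : 1 < p) :
    Summable (fun k : ℤ => (A / (1 + (k : ℝ) ^ 2)) ^ p) := by
  have h1 : Summable (fun k : ℤ => A ^ p * (1 / |(k : ℝ) + 0| ^ (2 : ℝ))) :=
    ((Real.summable_one_div_int_add_rpow 0 2).2 (by norm_num)).mul_left _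
  refine Summable.of_norm_bounded_eventually h1 ?_
  have : ∀ᶠ k : ℤ in Filter.cofinite, k ≠ 0 := by
    exact (Set.finite_singleton (0 : ℤ)).compl_mem_cofinite
  filter_upwards [this] with k hk
  have hk' : (0 : ℝ) < (k : ℝ) ^ 2 := by positivity
  rw [Real.norm_eq_abs, abs_of_nonneg (by positivity), div_eq_mul_one_div,
    Real.mul_rpow hA (by positivity)]
  refine mul_le_mul_of_nonneg_left ?_ (by positivity)
  have h3 : 1 / (1 + (k : ℝ) ^ 2) ≤ 1 := by
    rw [div_le_one (by positivity)]; linarith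
  refine (Real.rpow_le_rpow_of_exponent_ge (by positivity) h3 hp.le).trans ?_
  rw [Real.rpow_one, add_zero, Real.rpow_two, sq_abs]
  exact one_div_le_one_div_of_le hk' (by linarith)

/-- **Lemma 4.3 of [P1].** If `φ` is a Schwartz function with `φ̂` supported in
`[-1/100, 1/100]`, then for every `1 < p < ∞` the functions `g_N` are bounded in
`L^p(ℝ)` uniformly in `N`. -/
theorem gN_Lp_bounded (φ : SchwartzMap ℝ ℂ)
    (hφ_supp : ∀ ξ : ℝ, ft1 (⇑φ) ξ ≠ 0 → |ξ| ≤ 1 / 100)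
    (p : ℝ) (hp : 1 < p) :
    ∃ C : ℝ, ∀ N : ℕ, 1 ≤ N →
      eLpNorm (gN φ N) (ENNReal.ofReal p) volume ≤ ENNReal.ofReal C := by
  obtain ⟨A, hA, hb⟩ := aux_pointwise φ
  have hp0 : 0 < p := by linarith
  set I : ENNReal := ∫⁻ t : ℝ, ENNReal.ofReal ((1 + ‖t‖) ^ (-p)) with hI
  have hItop : I ≠ ⊤ := by
    have hint : Integrable (fun t : ℝ => (1 + ‖t‖) ^ (-p)) volume :=
      integrable_one_add_norm (by simpa using hp)
    exact hint.lintegral_lt_top.ne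
  set K : ENNReal := (∑' k : ℤ, ENNReal.ofReal ((A / (1 + (k : ℝ) ^ 2)) ^ p)) * I with hK
  have hKtop : K ≠ ⊤ :=
    ENNReal.mul_ne_top (aux_summable A hA p hp).tsum_ofReal_ne_top hItop
  refine ⟨(K ^ (1 / p)).toReal, fun N hN => ?_⟩
  rw [ENNReal.ofReal_toReal (ENNReal.rpow_ne_top_of_nonneg (by positivity) hKtop),
    eLpNorm_eq_lintegral_rpow_enorm_toReal (by simpa using hp0) ENNReal.ofReal_ne_top,
    ENNReal.toReal_ofReal hp0.le]
  refine ENNReal.rpow_le_rpow ?_ (by positivity)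
  calc ∫⁻ x, ‖gN φ N x‖ₑ ^ p
      ≤ ∫⁻ x : ℝ, ∑' k : ℤ, ENNReal.ofReal ((A / (1 + (k : ℝ) ^ 2)) ^ p)
          * ENNReal.ofReal ((1 + ‖x - k * N‖) ^ (-p)) := by
        refine lintegral_mono fun x => ?_
        refine le_trans ?_ (ENNReal.le_tsum (round (x / N)))
        have h := hb N hN x (round (x / N)) (abs_sub_round _)
        rw [← ofReal_norm, ENNReal.ofReal_rpow_of_nonneg (norm_nonneg _) hp0.le,
          ← ENNReal.ofReal_mul (by positivity)]
        refine ENNReal.ofReal_le_ofReal ?_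
        refine (Real.rpow_le_rpow (norm_nonneg _) h hp0.le).trans (le_of_eq ?_)
        rw [Real.mul_rpow (by positivity) (by positivity), Real.inv_rpow (by positivity),
          Real.rpow_neg (by positivity), Real.norm_eq_abs]
    _ = ∑' k : ℤ, ∫⁻ x : ℝ, ENNReal.ofReal ((A / (1 + (k : ℝ) ^ 2)) ^ p)
          * ENNReal.ofReal ((1 + ‖x - k * N‖) ^ (-p)) := by
        refine lintegral_tsum fun k => ?_
        exact (Measurable.aemeasurable (by fun_prop))
    _ = ∑' k : ℤ, ENNReal.ofReal ((A / (1 + (k : ℝ) ^ 2)) ^ p) * I := by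
        refine tsum_congr fun k => ?_
        rw [lintegral_const_mul' _ _ ENNReal.ofReal_ne_top,
          lintegral_sub_right_eq_self (fun t : ℝ => ENNReal.ofReal ((1 + ‖t‖) ^ (-p)))]
    _ ≤ K := by rw [ENNReal.tsum_mul_right]

end
end
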